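/- arXiv:2409.10886 — 3 statements merged into one kernel-verified Lean document; each statement's English description precedes it below -/
import Mathlib

section
/- Fix integers n ≥ 1 and d ≥ 1, and let 1 ≤ p < 2. For every f : {-1,1}^n → ℝ of degree at most d, one has ‖f‖_2 ≤ ρ_p^d ‖f‖_p, where ρ_p = (p−1)^{−1/2} for 1 < p < 2 and ρ_1 = e. -/
open Finset

/-- The Walsh polynomial with coefficients `c`, restricted to characters supported in `s`. -/
noncomputable def walshSum {ι : Type*} (s : Finset ι) (c : Finset ι → ℝ) (x : ι → Bool) : ℝ :=
  ∑ S ∈ s.powerset, c S * ∏ j ∈ S, (if x j then (1 : ℝ) else -1)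

section Walsh

variable {ι : Type*} [DecidableEq ι]

lemma walshSum_insert {s : Finset ι} {i : ι} (hi : i ∉ s) (c : Finset ι → ℝ) (x : ι → Bool) :
    walshSum (insert i s) c x = walshSum s c x +
      (if x i then (1 : ℝ) else -1) * walshSum s (fun S => c (insert i S)) x := by
  unfold walshSum
  rw [sum_powerset_insert hi, mul_sum]
  congr 1
  refine sum_congr rfl fun S hS => ?_
  rw [prod_insert fun h => hi (mem_powerset.1 hS h)]
  ring

lemma walshSum_update {s : Finset ι} {i : ι} (hi : i ∉ s) (c : Finset ι → ℝ) (x : ι → Bool)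
    (b : Bool) : walshSum s c (Function.update x i b) = walshSum s c x := by
  unfold walshSum
  refine sum_congr rfl fun S hS => ?_
  congr 1
  refine prod_congr rfl fun j hj => ?_
  rw [Function.update_of_ne]
  rintro rfl
  exact hi (mem_powerset.1 hS hj)

lemma sum_cube_eq_sum_update [Fintype ι] (i : ι) (G : (ι → Bool) → ℝ) :
    ∑ x, G x = ∑ x, (G (Function.update x i true) + G (Function.update x i false)) / 2 := by
  have hinv : Function.Involutive fun x : ι → Bool => Function.update x i (!x i) := by
    intro x
    simp
  have hflip : ∑ x, G (Function.update x i (!x i)) = ∑ x, G x :=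
    Equiv.sum_comp hinv.toPerm G
  have hpair : ∀ x : ι → Bool, G (Function.update x i true) + G (Function.update x i false)
      = G x + G (Function.update x i (!x i)) := by
    intro x
    have hx := Function.update_eq_self i x
    cases h : x i <;> rw [h] at hx <;> simp [hx, add_comm]
  simp_rw [hpair]
  rw [← sum_div, sum_add_distrib, hflip]
  ring

lemma sum_comp_walshSum_insert [Fintype ι] {s : Finset ι} {i : ι} (hi : i ∉ s)
    (c : Finset ι → ℝ) (φ : ℝ → ℝ) :
    ∑ x, φ (walshSum (insert i s) c x) =
      ∑ x, (φ (walshSum s c x + walshSum s (fun S => c (insert i S)) x) +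
        φ (walshSum s c x - walshSum s (fun S => c (insert i S)) x)) / 2 := by
  rw [sum_cube_eq_sum_update i]
  simp [walshSum_insert hi, walshSum_update hi, sub_eq_add_neg]

lemma sum_walshSum_sq [Fintype ι] (s : Finset ι) (c : Finset ι → ℝ) :
    ∑ x, walshSum s c x ^ 2 = 2 ^ Fintype.card ι * ∑ S ∈ s.powerset, c S ^ 2 := by
  induction s using Finset.induction_on generalizing c with
  | empty => simp [walshSum]
  | insert i s hi ih =>
    rw [sum_comp_walshSum_insert hi c (fun t => t ^ 2), sum_powerset_insert hi, mul_add, ← ih,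
      ← ih fun S => c (insert i S), ← sum_add_distrib]
    exact sum_congr rfl fun x _ => by ring

end Walsh

lemma two_le_rpow_one_add_add_rpow_one_sub {s y : ℝ} (hs : s ≤ 0) (hy0 : 0 ≤ y) (hy1 : y < 1) :
    2 ≤ (1 + y) ^ s + (1 - y) ^ s := by
  have h1 : 0 < 1 + y := by linarith
  have h2 : 0 < 1 - y := by linarith
  have hu := Real.rpow_pos_of_pos h1 s
  have hv := Real.rpow_pos_of_pos h2 s
  have huv : 1 ≤ (1 + y) ^ s * (1 - y) ^ s := by
    rw [← Real.mul_rpow h1.le h2.le]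
    exact Real.one_le_rpow_of_pos_of_le_one_of_nonpos (by positivity) (by nlinarith) hs
  nlinarith [sq_nonneg ((1 + y) ^ s - (1 - y) ^ s)]

lemma two_mul_le_rpow_one_add_sub_rpow_one_sub {q y : ℝ} (hq0 : 0 < q) (hq1 : q ≤ 1)
    (hy0 : 0 ≤ y) (hy1 : y < 1) : 2 * q * y ≤ (1 + y) ^ q - (1 - y) ^ q := by
  let h : ℝ → ℝ := fun y => (1 + y) ^ q - (1 - y) ^ q - 2 * q * y
  have hderiv : ∀ z ∈ Set.Ico (0 : ℝ) 1, HasDerivAt h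
      (q * ((1 + z) ^ (q - 1) + (1 - z) ^ (q - 1) - 2)) z := by
    intro z hz
    have h1 := ((hasDerivAt_id z).const_add 1).rpow_const (p := q) (Or.inl (by
      simp only [id]; linarith [hz.1]))
    have h2 := ((hasDerivAt_id z).const_sub 1).rpow_const (p := q) (Or.inl (by
      simp only [id]; linarith [hz.2]))
    refine ((h1.sub h2).sub ((hasDerivAt_id z).const_mul (2 * q))).congr_deriv ?_
    simp only [id]
    ring
  have hmono : MonotoneOn h (Set.Ico 0 1) := by
    refine monotoneOn_of_hasDerivWithinAt_nonneg (convex_Ico 0 1)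
      (fun z hz => (hderiv z hz).continuousAt.continuousWithinAt)
      (fun z hz => (hderiv z (interior_subset hz)).hasDerivWithinAt) fun z hz => ?_
    have hz' := interior_subset hz
    have := two_le_rpow_one_add_add_rpow_one_sub (s := q - 1) (by linarith) hz'.1 hz'.2
    exact mul_nonneg hq0.le (by linarith)
  have := hmono (Set.left_mem_Ico.2 one_pos) ⟨hy0, hy1⟩ hy0
  simp only [h] at this
  norm_num at this
  linarith

lemma one_add_mul_sq_le_rpow_add_rpow {p y : ℝ} (hp1 : 1 < p) (hp2 : p ≤ 2)
    (hy0 : 0 ≤ y) (hy1 : y ≤ 1) :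
    1 + p / 2 * ((p - 1) * y ^ 2) ≤ ((1 + y) ^ p + (1 - y) ^ p) / 2 := by
  let h : ℝ → ℝ := fun y => ((1 + y) ^ p + (1 - y) ^ p) / 2 - p / 2 * ((p - 1) * y ^ 2)
  have hderiv : ∀ z, HasDerivAt h
      (p / 2 * ((1 + z) ^ (p - 1) - (1 - z) ^ (p - 1) - 2 * (p - 1) * z)) z := by
    intro z
    have h1 := ((hasDerivAt_id z).const_add 1).rpow_const (p := p) (Or.inr hp1.le)
    have h2 := ((hasDerivAt_id z).const_sub 1).rpow_const (p := p) (Or.inr hp1.le)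
    refine (((h1.add h2).div_const 2).sub
      ((((hasDerivAt_id z).pow 2).const_mul (p - 1)).const_mul (p / 2))).congr_deriv ?_
    simp only [id]
    norm_num
    ring
  have hmono : MonotoneOn h (Set.Icc 0 1) := by
    refine monotoneOn_of_hasDerivWithinAt_nonneg (convex_Icc 0 1)
      (fun z hz => (hderiv z).continuousAt.continuousWithinAt)
      (fun z hz => (hderiv z).hasDerivWithinAt) fun z hz => ?_
    rw [interior_Icc] at hz
    have := two_mul_le_rpow_one_add_sub_rpow_one_sub (q := p - 1) (by linarith) (by linarith)
      hz.1.le hz.2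
    exact mul_nonneg (by linarith) (by linarith)
  have := hmono (Set.left_mem_Icc.2 zero_le_one) ⟨hy0, hy1⟩ hy0
  simp only [h] at this
  norm_num at this
  linarith

/-- The normalized form of Bonami's two-point inequality between `L^p` and `L^2`. -/
lemma two_point_inequality_one {p : ℝ} (hp1 : 1 < p) (hp2 : p ≤ 2) {y : ℝ} (hy : |y| ≤ 1) :
    (1 + (p - 1) * y ^ 2) ^ (p / 2) ≤ (|1 + y| ^ p + |1 - y| ^ p) / 2 := by
  have hsymm : |1 + y| ^ p + |1 - y| ^ p = (1 + |y|) ^ p + (1 - |y|) ^ p := by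
    obtain ⟨h1, h2⟩ := abs_le.1 hy
    rw [abs_of_nonneg (by linarith : 0 ≤ 1 + y), abs_of_nonneg (by linarith : 0 ≤ 1 - y)]
    rcases abs_cases y with ⟨h, -⟩ | ⟨h, -⟩ <;> rw [h]
    rw [sub_neg_eq_add, ← sub_eq_add_neg, add_comm]
  have hq : 0 ≤ (p - 1) * y ^ 2 := mul_nonneg (by linarith) (sq_nonneg y)
  rw [hsymm]
  calc (1 + (p - 1) * y ^ 2) ^ (p / 2) ≤ 1 + p / 2 * ((p - 1) * y ^ 2) :=
        rpow_one_add_le_one_add_mul_self (by linarith) (by linarith) (by linarith)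
    _ ≤ _ := by
        rw [← sq_abs y]
        exact one_add_mul_sq_le_rpow_add_rpow hp1 hp2 (abs_nonneg y) hy

lemma sq_rpow_half (a p : ℝ) : (a ^ 2) ^ (p / 2) = |a| ^ p := by
  rw [← sq_abs, ← Real.rpow_natCast, ← Real.rpow_mul (abs_nonneg a)]
  congr 1
  push_cast
  ring

/-- Bonami's two-point inequality between `L^p` and `L^2`. -/
lemma two_point_inequality {p : ℝ} (hp1 : 1 < p) (hp2 : p ≤ 2) (a b : ℝ) :
    (a ^ 2 + (p - 1) * b ^ 2) ^ (p / 2) ≤ (|a + b| ^ p + |a - b| ^ p) / 2 := by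
  wlog hab : |b| ≤ |a| generalizing a b with H
  · have hba : a ^ 2 ≤ b ^ 2 := sq_le_sq.2 (le_of_not_ge hab)
    calc (a ^ 2 + (p - 1) * b ^ 2) ^ (p / 2) ≤ (b ^ 2 + (p - 1) * a ^ 2) ^ (p / 2) := by
          refine Real.rpow_le_rpow ?_ (by nlinarith) (by linarith)
          have : 0 ≤ p - 1 := by linarith
          positivity
      _ ≤ _ := H b a (le_of_not_ge hab)
      _ = _ := by rw [add_comm b a, abs_sub_comm b a]
  rcases eq_or_ne a 0 with rfl | ha
  · obtain rfl : b = 0 := by simpa using hab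
    have h1 : p / 2 ≠ 0 := by linarith
    have h2 : p ≠ 0 := by linarith
    simp [h1, h2]
  · obtain ⟨y, rfl⟩ : ∃ y, b = a * y := ⟨b / a, by field_simp⟩
    have hy : |y| ≤ 1 := by
      rw [abs_mul] at hab
      exact le_of_mul_le_mul_left (by simpa using hab) (abs_pos.2 ha)
    have hq : 0 ≤ 1 + (p - 1) * y ^ 2 :=
      add_nonneg zero_le_one (mul_nonneg (by linarith) (sq_nonneg y))
    calc (a ^ 2 + (p - 1) * (a * y) ^ 2) ^ (p / 2)
        = |a| ^ p * (1 + (p - 1) * y ^ 2) ^ (p / 2) := by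
          rw [← sq_rpow_half, ← Real.mul_rpow (sq_nonneg a) hq]
          congr 1
          ring
      _ ≤ |a| ^ p * ((|1 + y| ^ p + |1 - y| ^ p) / 2) := by
          gcongr
          exact two_point_inequality_one hp1 hp2 hy
      _ = _ := by
          rw [show a + a * y = a * (1 + y) by ring, show a - a * y = a * (1 - y) by ring,
            abs_mul, abs_mul, Real.mul_rpow (abs_nonneg _) (abs_nonneg _),
            Real.mul_rpow (abs_nonneg _) (abs_nonneg _)]
          ring

lemma mul_rpow_le_sum_rpow_add {α : Type*} [Fintype α] {θ M u v : ℝ} (hθ0 : 0 < θ) (hθ1 : θ ≤ 1)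
    (hu : 0 ≤ u) (hv : 0 ≤ v) {A B : α → ℝ} (hA : ∀ x, 0 ≤ A x) (hB : ∀ x, 0 ≤ B x)
    (hAu : M * u ^ θ ≤ ∑ x, A x ^ θ) (hBv : M * v ^ θ ≤ ∑ x, B x ^ θ) :
    M * (u + v) ^ θ ≤ ∑ x, (A x + B x) ^ θ := by
  rcases (add_nonneg hu hv).eq_or_lt with hw | hw
  · rw [← hw, Real.zero_rpow hθ0.ne', mul_zero]
    exact sum_nonneg fun x _ => Real.rpow_nonneg (add_nonneg (hA x) (hB x)) _
  have hscale : ∀ {t : ℝ} {C : α → ℝ}, 0 ≤ t → (∀ x, 0 ≤ C x) →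
      M * t ^ θ ≤ ∑ x, C x ^ θ → M * t ≤ ∑ x, t * (C x / t) ^ θ := by
    intro t C ht hC h
    rcases ht.eq_or_lt with rfl | ht
    · simp
    have htθ := Real.rpow_pos_of_pos ht θ
    simp_rw [Real.div_rpow (hC _) ht.le]
    rw [← mul_sum, ← sum_div, mul_comm]
    exact mul_le_mul_of_nonneg_left ((le_div_iff₀ htθ).2 h) ht.le
  have hpoint : ∀ x, (u + v) ^ θ / (u + v) * (u * (A x / u) ^ θ + v * (B x / v) ^ θ)
      ≤ (A x + B x) ^ θ := by
    intro x
    have hdiv : ∀ {t c : ℝ}, 0 ≤ t → 0 ≤ c → t * (c / t) ≤ c := by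
      intro t c ht hc
      rcases ht.eq_or_lt with rfl | ht
      · simpa using hc
      · rw [mul_div_cancel₀ _ ht.ne']
    have hAx := div_nonneg (hA x) hu
    have hBx := div_nonneg (hB x) hv
    have hconc := (Real.concaveOn_rpow hθ0.le hθ1).2 hAx hBx
      (div_nonneg hu hw.le) (div_nonneg hv hw.le) (by field_simp)
    simp only [smul_eq_mul] at hconc
    calc (u + v) ^ θ / (u + v) * (u * (A x / u) ^ θ + v * (B x / v) ^ θ)
        = (u + v) ^ θ * (u / (u + v) * (A x / u) ^ θ + v / (u + v) * (B x / v) ^ θ) := by ring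
      _ ≤ (u + v) ^ θ * (u / (u + v) * (A x / u) + v / (u + v) * (B x / v)) ^ θ := by gcongr
      _ = (u * (A x / u) + v * (B x / v)) ^ θ := by
          rw [← Real.mul_rpow hw.le (by positivity)]
          congr 1
          rw [mul_add, ← mul_assoc, ← mul_assoc, mul_div_cancel₀ _ hw.ne',
            mul_div_cancel₀ _ hw.ne']
      _ ≤ (A x + B x) ^ θ := Real.rpow_le_rpow (by positivity)
          (add_le_add (hdiv hu (hA x)) (hdiv hv (hB x))) hθ0.le
  calc M * (u + v) ^ θ = (u + v) ^ θ / (u + v) * (M * u + M * v) := by field_simp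
    _ ≤ (u + v) ^ θ / (u + v) *
          (∑ x, u * (A x / u) ^ θ + ∑ x, v * (B x / v) ^ θ) := by
        gcongr
        · exact hscale hu hA hAu
        · exact hscale hv hB hBv
    _ = ∑ x, (u + v) ^ θ / (u + v) * (u * (A x / u) ^ θ + v * (B x / v) ^ θ) := by
        rw [← sum_add_distrib, mul_sum]
    _ ≤ _ := sum_le_sum fun x _ => hpoint x

/-- Bonami's hypercontractive inequality: the noise operator of parameter `√(p - 1)` is a
contraction from `L^p` to `L^2`. -/
lemma hypercontractivity {ι : Type*} [DecidableEq ι] [Fintype ι] {p : ℝ} (hp1 : 1 < p)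
    (hp2 : p ≤ 2) (s : Finset ι) (c : Finset ι → ℝ) :
    2 ^ Fintype.card ι * (∑ S ∈ s.powerset, (p - 1) ^ #S * c S ^ 2) ^ (p / 2)
      ≤ ∑ x, |walshSum s c x| ^ p := by
  have hq : 0 ≤ p - 1 := by linarith
  induction s using Finset.induction_on generalizing c with
  | empty => simp [walshSum, sq_rpow_half]
  | insert i s hi ih =>
    rw [sum_comp_walshSum_insert hi c (fun t => |t| ^ p), sum_powerset_insert hi]
    have hins : ∑ S ∈ s.powerset, (p - 1) ^ #(insert i S) * c (insert i S) ^ 2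
        = (p - 1) * ∑ S ∈ s.powerset, (p - 1) ^ #S * c (insert i S) ^ 2 := by
      rw [mul_sum]
      refine sum_congr rfl fun S hS => ?_
      rw [card_insert_of_notMem fun h => hi (mem_powerset.1 hS h)]
      ring
    rw [hins]
    refine le_trans (mul_rpow_le_sum_rpow_add (by linarith) (by linarith)
      (sum_nonneg fun S _ => by positivity) (mul_nonneg hq (sum_nonneg fun S _ => by positivity))
      (A := fun x => walshSum s c x ^ 2)
      (B := fun x => (p - 1) * walshSum s (fun S => c (insert i S)) x ^ 2)
      (fun x => by positivity) (fun x => by positivity) ?_ ?_)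
      (sum_le_sum fun x _ => two_point_inequality hp1 hp2 _ _)
    · simpa only [sq_rpow_half] using ih c
    · simp_rw [Real.mul_rpow hq (sq_nonneg _), sq_rpow_half]
      rw [Real.mul_rpow hq (sum_nonneg fun S _ => by positivity), ← mul_sum, mul_left_comm]
      gcongr
      exact ih _

lemma mul_sum_sq_rpow_le {ι : Type*} [DecidableEq ι] [Fintype ι] {p : ℝ} (hp1 : 1 < p)
    (hp2 : p ≤ 2) {d : ℕ} {c : Finset ι → ℝ} (hdeg : ∀ S : Finset ι, d < #S → c S = 0) :
    ((p - 1) ^ d * ((∑ x, |walshSum univ c x| ^ (2 : ℝ)) / 2 ^ Fintype.card ι)) ^ (p / 2)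
      ≤ (∑ x, |walshSum univ c x| ^ p) / 2 ^ Fintype.card ι := by
  have hq : 0 ≤ p - 1 := by linarith
  simp_rw [Real.rpow_two, sq_abs]
  rw [sum_walshSum_sq, mul_div_cancel_left₀ _ (by positivity), le_div_iff₀ (by positivity),
    mul_comm _ (2 ^ _)]
  refine le_trans ?_ (hypercontractivity hp1 hp2 univ c)
  rw [mul_sum]
  refine mul_le_mul_of_nonneg_left (Real.rpow_le_rpow (sum_nonneg fun S _ => by positivity)
    (sum_le_sum fun S _ => ?_) (by linarith)) (by positivity)
  rcases lt_or_ge d #S with h | h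
  · simp [hdeg S h]
  · exact mul_le_mul_of_nonneg_right (pow_le_pow_of_le_one hq (by linarith) h) (sq_nonneg _)

/-- Log-convexity of moments between the exponents `1` and `2`. -/
lemma sum_rpow_div_le {α : Type*} [Fintype α] {t M : ℝ} (ht1 : 1 ≤ t) (ht2 : t ≤ 2)
    (hM : 0 < M) (g : α → ℝ) (hL : 0 < (∑ x, |g x|) / M)
    (hN : 0 < (∑ x, |g x| ^ (2 : ℝ)) / M) :
    (∑ x, |g x| ^ t) / M
      ≤ ((∑ x, |g x|) / M) ^ (2 - t) * ((∑ x, |g x| ^ (2 : ℝ)) / M) ^ (t - 1) := by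
  set L := (∑ x, |g x|) / M with hLdef
  set N := (∑ x, |g x| ^ (2 : ℝ)) / M with hNdef
  have hpoint : ∀ x, |g x| ^ t
      ≤ L ^ (2 - t) * N ^ (t - 1) * ((2 - t) * (|g x| / L) + (t - 1) * (|g x| ^ (2 : ℝ) / N)) := by
    intro x
    have ha := abs_nonneg (g x)
    have hyoung := Real.geom_mean_le_arith_mean2_weighted (w₁ := 2 - t) (w₂ := t - 1)
      (by linarith) (by linarith) (div_nonneg ha hL.le)
      (div_nonneg (Real.rpow_nonneg ha 2) hN.le) (by ring)
    refine le_trans (le_of_eq ?_) (mul_le_mul_of_nonneg_left hyoung (by positivity))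
    rw [Real.div_rpow ha hL.le, Real.div_rpow (Real.rpow_nonneg ha 2) hN.le,
      ← Real.rpow_mul ha]
    have h1 := (Real.rpow_pos_of_pos hL (2 - t)).ne'
    have h2 := (Real.rpow_pos_of_pos hN (t - 1)).ne'
    field_simp
    rw [← Real.rpow_add_of_nonneg ha (by linarith) (by linarith)]
    congr 1
    ring
  rw [div_le_iff₀ hM]
  refine (sum_le_sum fun x _ => hpoint x).trans (le_of_eq ?_)
  rw [← mul_sum, sum_add_distrib, ← mul_sum, ← mul_sum, ← sum_div, ← sum_div,
    (div_eq_iff hM.ne').1 hLdef.symm, (div_eq_iff hM.ne').1 hNdef.symm]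
  field_simp
  ring

lemma half_log_le_log_add {N L : ℝ} {d : ℕ} (hN : 0 < N) (hL : 0 < L)
    (h : ∀ t : ℝ, 1 < t → t < 2 →
      ((t - 1) ^ d * N) ^ (t / 2) ≤ L ^ (2 - t) * N ^ (t - 1)) :
    Real.log N / 2 ≤ d + Real.log L := by
  have hslope : Filter.Tendsto (fun u : ℝ => (u - 1)⁻¹ * Real.log u) (nhdsWithin 1 (Set.Iio 1))
      (nhds 1) := by
    have h1 := (Real.hasDerivAt_log (one_ne_zero)).tendsto_slope
    have h2 := h1.mono_left (nhdsLT_le_nhdsNE 1)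
    simpa [slope_fun_def] using h2
  have hlim : Filter.Tendsto
      (fun u : ℝ => (u + 1) / 2 * (d * ((u - 1)⁻¹ * Real.log u)) + Real.log L)
      (nhdsWithin 1 (Set.Iio 1)) (nhds ((1 + 1) / 2 * (d * 1) + Real.log L)) := by
    refine Filter.Tendsto.add_const _ (Filter.Tendsto.mul ?_ (hslope.const_mul _))
    exact ((continuous_id.add continuous_const).div_const 2).continuousAt.tendsto.mono_left
      nhdsWithin_le_nhds
  have hle : Real.log N / 2 ≤ (1 + 1) / 2 * (d * 1) + Real.log L := by
    refine ge_of_tendsto hlim ?_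
    filter_upwards [Ioo_mem_nhdsLT (zero_lt_one' ℝ)] with u hu
    have hu0 : 0 < u := hu.1
    have hu1 : 0 < 1 - u := by linarith [hu.2]
    have hlog := h (u + 1) (by linarith) (by linarith)
    rw [add_sub_cancel_right] at hlog
    have hlog := Real.log_le_log (by positivity) hlog
    rw [Real.log_rpow (by positivity), Real.log_mul (by positivity) hN.ne', Real.log_pow,
      Real.log_mul (by positivity) (by positivity), Real.log_rpow hL, Real.log_rpow hN] at hlog
    have hne : u - 1 ≠ 0 := by linarith
    have hkey : (1 - u) * (Real.log N / 2) ≤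
        (1 - u) * ((u + 1) / 2 * (d * ((u - 1)⁻¹ * Real.log u)) + Real.log L) := by
      have : (1 - u) * ((u + 1) / 2 * (d * ((u - 1)⁻¹ * Real.log u)) + Real.log L)
          = -((u + 1) / 2 * (d * Real.log u)) + (1 - u) * Real.log L := by
        field_simp
        ring
      rw [this]
      linarith
    exact le_of_mul_le_mul_left hkey hu1
  linarith

/-- Hypercontractive moment comparison: if `f : {-1,1}ⁿ → ℝ` has degree at most `d` and
`1 ≤ p < 2`, then `‖f‖₂ ≤ ρ_p^d ‖f‖_p`, where `ρ_p = (p-1)^{-1/2}` for `1 < p < 2` and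
`ρ_1 = e`. -/
theorem stmt6 (n d : ℕ) (hn : 1 ≤ n) (hd : 1 ≤ d) (p : ℝ) (hp1 : 1 ≤ p) (hp2 : p < 2)
    (f : (Fin n → Bool) → ℝ) (fhat : Finset (Fin n) → ℝ)
    (hexp : ∀ x, f x = ∑ S : Finset (Fin n),
      fhat S * ∏ j ∈ S, (if x j then (1 : ℝ) else -1))
    (hdeg : ∀ S : Finset (Fin n), d < S.card → fhat S = 0)
    (ρ : ℝ)
    (hρ : (p = 1 ∧ ρ = Real.exp 1) ∨ (1 < p ∧ ρ = (p - 1) ^ (-(1 : ℝ) / 2))) :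
    ((∑ x : Fin n → Bool, |f x| ^ (2 : ℝ)) / 2 ^ n) ^ ((1 : ℝ) / 2)
      ≤ ρ ^ d * ((∑ x : Fin n → Bool, |f x| ^ p) / 2 ^ n) ^ ((1 : ℝ) / p) := by
  obtain rfl : f = walshSum univ fhat := by
    funext x
    rw [hexp, walshSum, powerset_univ]
  have hcore : ∀ t : ℝ, 1 < t → t ≤ 2 →
      ((t - 1) ^ d * ((∑ x, |walshSum univ fhat x| ^ (2 : ℝ)) / 2 ^ n)) ^ (t / 2)
        ≤ (∑ x, |walshSum univ fhat x| ^ t) / 2 ^ n := fun t h1 h2 => by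
    simpa only [Fintype.card_fin] using mul_sum_sq_rpow_le h1 h2 hdeg
  set N := (∑ x, |walshSum univ fhat x| ^ (2 : ℝ)) / 2 ^ n with hNdef
  have hN0 : 0 ≤ N := by positivity
  rcases hρ with ⟨rfl, rfl⟩ | ⟨hp, rfl⟩
  · simp_rw [Real.rpow_one, div_one, Real.rpow_one]
    rcases hN0.eq_or_lt with hN | hN
    · rw [← hN, Real.zero_rpow (by norm_num)]
      positivity
    have hL : 0 < (∑ x, |walshSum univ fhat x|) / 2 ^ n := by
      refine div_pos (lt_of_le_of_ne (sum_nonneg fun x _ => abs_nonneg _) fun h0 => ?_)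
        (by positivity)
      have hzero := (sum_eq_zero_iff_of_nonneg fun x _ => abs_nonneg _).1 h0.symm
      refine hN.ne' ?_
      rw [hNdef, sum_eq_zero fun x hx => by rw [hzero x hx, Real.zero_rpow two_ne_zero], zero_div]
    have hlog := half_log_le_log_add hN hL fun t h1 h2 => (hcore t h1 h2.le).trans
      (sum_rpow_div_le h1.le h2.le (by positivity) _ hL hN)
    rw [← Real.log_le_log_iff (by positivity) (by positivity), Real.log_rpow hN,
      Real.log_mul (by positivity) hL.ne', Real.log_pow, Real.log_exp]
    linarith
  · have hq : 0 < p - 1 := by linarith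
    have hroot := Real.rpow_le_rpow (by positivity) (hcore p hp hp2.le)
      (by positivity : 0 ≤ 1 / p)
    rw [← Real.rpow_mul (by positivity), show p / 2 * (1 / p) = 1 / 2 by field_simp,
      Real.mul_rpow (by positivity) hN0] at hroot
    have hcancel : ((p - 1) ^ (-(1 : ℝ) / 2)) ^ d * ((p - 1) ^ d) ^ ((1 : ℝ) / 2) = 1 := by
      rw [← Real.rpow_natCast, ← Real.rpow_natCast, ← Real.rpow_mul hq.le, ← Real.rpow_mul hq.le,
        ← Real.rpow_add hq]
      ring_nf
      exact Real.rpow_zero _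
    calc N ^ ((1 : ℝ) / 2)
        = ((p - 1) ^ (-(1 : ℝ) / 2)) ^ d * (((p - 1) ^ d) ^ ((1 : ℝ) / 2) * N ^ ((1 : ℝ) / 2)) := by
          rw [← mul_assoc, hcancel, one_mul]
      _ ≤ _ := by gcongr
end

section
/- Let P : ℝ^n → ℝ be a homogeneous polynomial of degree d and let L : (ℝ^n)^d → ℝ be the unique symmetric d-linear form satisfying L(x, …, x) = P(x) for all x ∈ ℝ^n. Then for every 1 ≤ k ≤ d and all x, y ∈ [−1,1]^n, |L(x, …, x, y, …, y)| ≤ [(1+√2)^d d^d / (k^k (d−k)^{d−k})] · [k!(d−k)!/d!] · sup_{u ∈ [−1,1]^n} |P(u)|, where x appears k times and y appears d−k times in L, and the convention 0^0 = 1 is used when k = d. -/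
open Finset

/-- The functional reading off the coefficient of `X ^ k` of a polynomial of degree at most `k`
from its values at the Chebyshev nodes in `[-1, 1]` has norm at most `2 ^ k`. -/
theorem exists_leadingCoeff_functional (k : ℕ) :
    ∃ w : ℕ → ℝ, (∀ j ≤ k, ∑ i ∈ range (k + 1),
        w i * Polynomial.Chebyshev.node k i ^ j = if j = k then 1 else 0) ∧
      ∑ i ∈ range (k + 1), |w i| ≤ 2 ^ k := by
  set x := Polynomial.Chebyshev.node k
  set w : ℕ → ℝ := fun i ↦ (∏ j ∈ (range (k + 1)).erase i, (x i - x j))⁻¹ with hw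
  have hcoeff (P : Polynomial ℝ) (hP : P.degree ≤ k) :
      P.coeff k = ∑ i ∈ range (k + 1), w i * P.eval (x i) := by
    have hlt : P.degree < (range (k + 1)).card := by
      rw [card_range]
      exact lt_of_le_of_lt hP (by exact_mod_cast Nat.lt_succ_self k)
    have h := Lagrange.coeff_eq_sum (Polynomial.Chebyshev.strictAntiOn_node k).injOn hlt
    rw [card_range, Nat.add_sub_cancel] at h
    rw [h]
    exact sum_congr rfl fun i _ ↦ by rw [hw, div_eq_inv_mul]
  refine ⟨w, fun j hj ↦ ?_, ?_⟩
  · have h := hcoeff (Polynomial.X ^ j) ((Polynomial.degree_X_pow_le j).trans (by exact_mod_cast hj))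
    simp only [Polynomial.coeff_X_pow, Polynomial.eval_pow, Polynomial.eval_X] at h
    rw [← h]
    simp only [eq_comm]
  · have habs (i : ℕ) (hi : i ∈ range (k + 1)) :
        |w i| = w i * (Polynomial.Chebyshev.T ℝ k).eval (x i) := by
      have hik : i ≤ k := Nat.lt_succ_iff.mp (mem_range.mp hi)
      have hpos : 0 < (-1) ^ i * w i := by
        have := inv_pos_of_pos (Polynomial.Chebyshev.zero_lt_prod_node_sub_node hik)
        rwa [mul_inv, ← inv_pow, inv_neg_one] at this
      rw [Polynomial.Chebyshev.eval_T_real_node (mem_Iic.mpr hik), mul_comm, ← abs_of_pos hpos,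
        abs_mul, abs_neg_one_pow, one_mul]
    rw [sum_congr rfl habs, ← hcoeff _ (by simp)]
    calc (Polynomial.Chebyshev.T ℝ k).coeff k = (Polynomial.Chebyshev.T ℝ k).leadingCoeff := by
          simp [Polynomial.leadingCoeff]
      _ = 2 ^ (k - 1) := by simp
      _ ≤ 2 ^ k := pow_le_pow_right₀ one_le_two (Nat.sub_le k 1)

section MultilinearMap

variable {n d : ℕ} (L : MultilinearMap ℝ (fun _ : Fin d => (Fin n → ℝ)) ℝ)

theorem exists_abs_apply_const_le :
    ∃ C : ℝ, ∀ u : Fin n → ℝ, (∀ j, |u j| ≤ 1) → |L (fun _ => u)| ≤ C := by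
  refine ⟨∑ r : Fin d → Fin n, |L (fun i ↦ Pi.single (r i) 1)|, fun u hu ↦ ?_⟩
  have hexp : L (fun _ ↦ u) =
      ∑ r : Fin d → Fin n, (∏ i, u (r i)) * L (fun i ↦ Pi.single (r i) 1) := by
    have hsum : (fun _ : Fin d ↦ u) =
        fun _ ↦ ∑ j, u j • (Pi.single j 1 : Fin n → ℝ) :=
      funext fun _ ↦ (pi_eq_sum_univ' u).trans (by simp)
    rw [hsum, L.map_sum]
    exact sum_congr rfl fun r _ ↦ by
      rw [L.map_smul_univ (fun i ↦ u (r i)) (fun i ↦ Pi.single (r i) 1), smul_eq_mul]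
  rw [hexp]
  refine (abs_sum_le_sum_abs _ _).trans (sum_le_sum fun r _ ↦ ?_)
  rw [abs_mul, abs_prod]
  exact mul_le_of_le_one_left (abs_nonneg _)
    (prod_le_one (fun _ _ ↦ abs_nonneg _) fun i _ ↦ hu (r i))

theorem abs_apply_const_le_iSup {u : Fin n → ℝ} (hu : ∀ j, |u j| ≤ 1) :
    |L (fun _ => u)| ≤ ⨆ (u : Fin n → ℝ) (_ : ∀ j, |u j| ≤ 1), |L (fun _ => u)| := by
  obtain ⟨C, hC⟩ := exists_abs_apply_const_le L
  have hbdd : BddAbove (Set.range fun u : Fin n → ℝ ↦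
      ⨆ (_ : ∀ j, |u j| ≤ 1), |L (fun _ => u)|) := by
    refine ⟨max C 0, ?_⟩
    rintro _ ⟨v, rfl⟩
    exact Real.iSup_le (fun hv ↦ (hC v hv).trans (le_max_left _ _)) (le_max_right _ _)
  exact (ciSup_pos (f := fun _ ↦ |L (fun _ => u)|) hu).ge.trans (le_ciSup hbdd u)

theorem apply_const_smul_add_smul (s t : ℝ) (x y : Fin n → ℝ) :
    L (fun _ => s • x + t • y) = ∑ S : Finset (Fin d),
      s ^ S.card * t ^ (d - S.card) * L (fun i => if i ∈ S then x else y) := by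
  have h := L.map_add_univ (fun _ ↦ s • x) (fun _ ↦ t • y)
  refine h.trans (sum_congr rfl fun S _ ↦ ?_)
  have hsmul : (S.piecewise (fun _ ↦ s • x) (fun _ ↦ t • y) : Fin d → Fin n → ℝ) =
      fun i ↦ (if i ∈ S then s else t) • (if i ∈ S then x else y) := by
    funext i
    by_cases hi : i ∈ S <;> simp [hi]
  rw [hsmul, L.map_smul_univ, smul_eq_mul, prod_ite, prod_const, prod_const]
  congr 3
  · simp
  · rw [filter_not, filter_mem_eq_inter, univ_inter, card_sdiff_of_subset (subset_univ S),
      card_univ, Fintype.card_fin]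

variable {L}

theorem apply_ite_mem_eq_of_card_eq
    (hsym : ∀ (σ : Equiv.Perm (Fin d)) (v : Fin d → (Fin n → ℝ)), L (fun i => v (σ i)) = L v)
    {S T : Finset (Fin d)} (hST : S.card = T.card) (x y : Fin n → ℝ) :
    L (fun i => if i ∈ S then x else y) = L (fun i => if i ∈ T then x else y) := by
  have e : {i // i ∈ S} ≃ {i // i ∈ T} := Finset.equivOfCardEq hST
  rw [← hsym e.extendSubtype fun i ↦ if i ∈ T then x else y]
  congr 1
  funext i
  by_cases hi : i ∈ S
  · simp [hi, e.extendSubtype_mem i hi]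
  · simp [hi, e.extendSubtype_not_mem i hi]

/-- Applying the leading-coefficient functionals of degrees `k` and `d - k` in `s` and `t` to
`L (s x + t y, …, s x + t y)` isolates the mixed term of bidegree `(k, d - k)`. -/
theorem choose_mul_abs_apply_le {k : ℕ} (hkd : k ≤ d)
    (hsym : ∀ (σ : Equiv.Perm (Fin d)) (v : Fin d → (Fin n → ℝ)), L (fun i => v (σ i)) = L v)
    (x y : Fin n → ℝ) {M : ℝ}
    (hM : ∀ s ∈ Set.Icc (-1 : ℝ) 1, ∀ t ∈ Set.Icc (-1 : ℝ) 1, |L (fun _ => s • x + t • y)| ≤ M) :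
    d.choose k * |L (fun i => if (i : ℕ) < k then x else y)| ≤ 2 ^ d * M := by
  obtain ⟨w, hw, hw_norm⟩ := exists_leadingCoeff_functional k
  obtain ⟨w', hw', hw'_norm⟩ := exists_leadingCoeff_functional (d - k)
  set p := Polynomial.Chebyshev.node k
  set q := Polynomial.Chebyshev.node (d - k)
  have hM0 : 0 ≤ M := (abs_nonneg _).trans (hM 0 (by simp) 0 (by simp))
  have hcoeff (m : ℕ) (hm : m ≤ d) :
      (∑ a ∈ range (k + 1), w a * p a ^ m) *
        (∑ b ∈ range (d - k + 1), w' b * q b ^ (d - m)) = if m = k then 1 else 0 := by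
    rcases le_total m k with h | h
    · rw [hw m h]
      split_ifs with hmk
      · rw [hmk, hw' _ le_rfl, if_pos rfl, one_mul]
      · rw [zero_mul]
    · rw [hw' (d - m) (by omega)]
      by_cases hmk : m = k
      · rw [hmk, hw k le_rfl]
        simp
      · rw [if_neg (by omega), if_neg hmk, mul_zero]
  have hmain : ∑ a ∈ range (k + 1), ∑ b ∈ range (d - k + 1),
      w a * w' b * L (fun _ => p a • x + q b • y) =
        d.choose k * L (fun i => if (i : ℕ) < k then x else y) := by
    calc _ = ∑ S : Finset (Fin d), ((∑ a ∈ range (k + 1), w a * p a ^ S.card) *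
          (∑ b ∈ range (d - k + 1), w' b * q b ^ (d - S.card))) *
            L (fun i => if i ∈ S then x else y) := by
          simp_rw [sum_mul_sum, sum_mul, apply_const_smul_add_smul, mul_sum]
          conv_rhs => rw [sum_comm]
          refine sum_congr rfl fun a _ ↦ ?_
          rw [sum_comm]
          exact sum_congr rfl fun S _ ↦ sum_congr rfl fun b _ ↦ by ring
      _ = ∑ S : Finset (Fin d), if S.card = k then
            L (fun i => if (i : ℕ) < k then x else y) else 0 := by
          refine sum_congr rfl fun S _ ↦ ?_
          rw [hcoeff S.card (by simpa using S.card_le_univ)]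
          split_ifs with hS
          · have hcard : S.card = (univ.filter fun i : Fin d ↦ (i : ℕ) < k).card := by
              rw [hS, Fin.card_filter_val_lt, min_eq_right hkd]
            rw [one_mul, apply_ite_mem_eq_of_card_eq hsym hcard]
            simp
          · rw [zero_mul]
      _ = _ := by
          rw [← sum_filter, sum_const, nsmul_eq_mul, ← powerset_univ, ← powersetCard_eq_filter,
            card_powersetCard, card_univ, Fintype.card_fin]
  calc (d.choose k : ℝ) * |L (fun i => if (i : ℕ) < k then x else y)|
      = |∑ a ∈ range (k + 1), ∑ b ∈ range (d - k + 1),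
          w a * w' b * L (fun _ => p a • x + q b • y)| := by
        rw [hmain, abs_mul, Nat.abs_cast]
    _ ≤ ∑ a ∈ range (k + 1), ∑ b ∈ range (d - k + 1), |w a| * |w' b| * M := by
        refine (abs_sum_le_sum_abs _ _).trans (sum_le_sum fun a _ ↦ ?_)
        refine (abs_sum_le_sum_abs _ _).trans (sum_le_sum fun b _ ↦ ?_)
        rw [abs_mul, abs_mul]
        gcongr
        exact hM _ Polynomial.Chebyshev.node_mem_Icc _ Polynomial.Chebyshev.node_mem_Icc
    _ = (∑ a ∈ range (k + 1), |w a|) * (∑ b ∈ range (d - k + 1), |w' b|) * M := by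
        simp_rw [sum_mul_sum, sum_mul]
    _ ≤ 2 ^ k * 2 ^ (d - k) * M := by gcongr
    _ = 2 ^ d * M := by rw [← pow_add, Nat.add_sub_cancel' hkd]

end MultilinearMap

/-- Polarization: let `L` be a symmetric `d`-linear form on `ℝⁿ` and `P(x) = L(x,…,x)` the
associated homogeneous polynomial of degree `d`. Then for `1 ≤ k ≤ d` and `x, y ∈ [-1,1]ⁿ`,
`|L(x,…,x,y,…,y)| ≤ (1+√2)^d d^d / (k^k (d-k)^{d-k}) · k!(d-k)!/d! · sup_{u ∈ [-1,1]ⁿ} |P(u)|`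
(with `x` in the first `k` slots and `y` in the remaining `d - k` slots). -/
theorem stmt7 (n d k : ℕ) (hd : 1 ≤ d) (hk : 1 ≤ k) (hkd : k ≤ d)
    (L : MultilinearMap ℝ (fun _ : Fin d => (Fin n → ℝ)) ℝ)
    (hsym : ∀ (σ : Equiv.Perm (Fin d)) (v : Fin d → (Fin n → ℝ)),
      L (fun i => v (σ i)) = L v)
    (x y : Fin n → ℝ) (hx : ∀ j, |x j| ≤ 1) (hy : ∀ j, |y j| ≤ 1) :
    |L (fun i => if (i : ℕ) < k then x else y)|
      ≤ ((1 + Real.sqrt 2) ^ d * (d : ℝ) ^ d / ((k : ℝ) ^ k * ((d - k : ℕ) : ℝ) ^ (d - k)))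
          * ((k.factorial : ℝ) * ((d - k).factorial : ℝ) / (d.factorial : ℝ))
          * ⨆ (u : Fin n → ℝ) (_ : ∀ j, |u j| ≤ 1), |L (fun _ => u)| := by
  set M : ℝ := ⨆ (u : Fin n → ℝ) (_ : ∀ j, |u j| ≤ 1), |L (fun _ => u)|
  have hM0 : 0 ≤ M := Real.iSup_nonneg fun _ ↦ Real.iSup_nonneg fun _ ↦ abs_nonneg _
  have hd0 : (0 : ℝ) < d := by exact_mod_cast hd
  set r : ℝ := k / d with hr
  set ρ : ℝ := (d - k : ℕ) / d with hρ
  have hsum : r + ρ = 1 := by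
    rw [hr, hρ, Nat.cast_sub hkd]
    field_simp
    ring
  have hr0 : 0 ≤ r := by positivity
  have hρ0 : 0 ≤ ρ := by positivity
  have hcube (s : ℝ) (hs : s ∈ Set.Icc (-1 : ℝ) 1) (t : ℝ) (ht : t ∈ Set.Icc (-1 : ℝ) 1) :
      |L (fun _ => s • (r • x) + t • (ρ • y))| ≤ M := by
    refine abs_apply_const_le_iSup L fun j ↦ ?_
    have hterm {c a z : ℝ} (hc : c ∈ Set.Icc (-1 : ℝ) 1) (ha : 0 ≤ a) (hz : |z| ≤ 1) :
        |c * (a * z)| ≤ a := by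
      rw [abs_mul, abs_mul, abs_of_nonneg ha]
      exact (mul_le_of_le_one_left (by positivity) (abs_le.mpr hc)).trans
        (mul_le_of_le_one_right ha hz)
    calc |s * (r * x j) + t * (ρ * y j)| ≤ |s * (r * x j)| + |t * (ρ * y j)| := abs_add_le _ _
      _ ≤ r + ρ := add_le_add (hterm hs hr0 (hx j)) (hterm ht hρ0 (hy j))
      _ = 1 := hsum
  have hbound := choose_mul_abs_apply_le hkd hsym (r • x) (ρ • y) hcube
  have hscale : L (fun i ↦ if (i : ℕ) < k then r • x else ρ • y) =
      r ^ k * ρ ^ (d - k) * L (fun i ↦ if (i : ℕ) < k then x else y) := by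
    have hsmul : (fun i : Fin d ↦ if (i : ℕ) < k then r • x else ρ • y) =
        fun i : Fin d ↦ (if (i : ℕ) < k then r else ρ) • (if (i : ℕ) < k then x else y) := by
      funext i
      split_ifs <;> rfl
    rw [hsmul, L.map_smul_univ, smul_eq_mul, prod_ite, prod_const, prod_const, filter_not,
      card_sdiff_of_subset (filter_subset _ _), card_univ, Fintype.card_fin,
      Fin.card_filter_val_lt, min_eq_right hkd]
  have hr_pow : r ^ k * ρ ^ (d - k) = (k : ℝ) ^ k * ((d - k : ℕ) : ℝ) ^ (d - k) / (d : ℝ) ^ d := by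
    rw [hr, hρ, div_pow, div_pow, div_mul_div_comm, ← pow_add, Nat.add_sub_cancel' hkd]
  have hkk : (0 : ℝ) < (k : ℝ) ^ k * ((d - k : ℕ) : ℝ) ^ (d - k) := by
    exact_mod_cast Nat.mul_pos Nat.pow_self_pos Nat.pow_self_pos
  have h2 : (2 : ℝ) ≤ 1 + Real.sqrt 2 := by
    have := Real.one_le_sqrt.mpr (one_le_two (α := ℝ))
    linarith
  have h2d : (2 : ℝ) ^ d * M ≤ (1 + Real.sqrt 2) ^ d * M := by gcongr
  rw [hscale, abs_mul, abs_of_nonneg (by positivity), hr_pow, Nat.cast_choose ℝ hkd] at hbound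
  have hd_fact : (0 : ℝ) < d.factorial := by positivity
  have hk_fact : (0 : ℝ) < k.factorial * (d - k).factorial := by positivity
  have hdd : (0 : ℝ) < (d : ℝ) ^ d := by positivity
  generalize (k : ℝ) ^ k * ((d - k : ℕ) : ℝ) ^ (d - k) = A at *
  generalize (k.factorial : ℝ) * ((d - k).factorial : ℝ) = B at *
  have hle := hbound.trans h2d
  calc _ = (d : ℝ) ^ d / A * (B / d.factorial) * (d.factorial / B * (A / (d : ℝ) ^ d *
        |L (fun i => if (i : ℕ) < k then x else y)|)) := by field_simp
    _ ≤ (d : ℝ) ^ d / A * (B / d.factorial) * ((1 + Real.sqrt 2) ^ d * M) := by gcongr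
    _ = _ := by ring
end

section
/- Fix an integer d ≥ 1. There exists a constant C(d) > 0 depending only on d such that for every n ≥ 1 and every A ∈ M_2(ℂ)^{⊗n} of degree at most d, one has (∑_{s ∈ {0,1,2,3}^n} |Â_s|^{2d/(d+1)})^{(d+1)/(2d)} ≤ C(d) ‖A‖, where ‖A‖ is the operator norm of A. -/
open Finset

/-- The four Pauli matrices `σ₀, σ₁, σ₂, σ₃`. -/
noncomputable def pauli : Fin 4 → Matrix (Fin 2) (Fin 2) ℂ :=
  ![!![1, 0; 0, 1], !![0, 1; 1, 0], !![0, -Complex.I; Complex.I, 0], !![1, 0; 0, -1]]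

/-- The tensor product `σ_s = σ_{s 1} ⊗ ⋯ ⊗ σ_{s n}` as a matrix indexed by `(Fin n → Fin 2)`. -/
noncomputable def pauliTensor {n : ℕ} (s : Fin n → Fin 4) :
    Matrix (Fin n → Fin 2) (Fin n → Fin 2) ℂ :=
  Matrix.of fun x y => ∏ j, pauli (s j) (x j) (y j)


/-- The Bloch vector, extended by `1` in position `0`, of the eigenstate of `σ_{p+1}` with
eigenvalue `1` (`b = true`) or `-1` (`b = false`), where `ω = (p, b)`. -/
noncomputable def blochVec (ω : Fin 3 × Bool) (q : Fin 4) : ℂ :=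
  if q = 0 then 1 else if q = ω.1.succ then (if ω.2 then 1 else -1) else 0

/-- The multilinear form with coefficients `a` evaluated at `Y`. -/
noncomputable def formEval {n : ℕ} (a : (Fin n → Fin 4) → ℂ) (Y : Fin n → Fin 4 → ℂ) : ℂ :=
  ∑ s, a s * ∏ j, Y j (s j)

lemma exists_state_blochVec (ω : Fin 3 × Bool) :
    ∃ ψ : Fin 2 → ℂ, ∀ q, ∑ x, ∑ y, star (ψ x) * pauli q x y * ψ y = blochVec ω q := by
  obtain ⟨c, hc, hs⟩ : ∃ c : ℂ, c ^ 2 = 1 / 2 ∧ (starRingEnd ℂ) c = c := by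
    refine ⟨((√2 : ℝ) : ℂ)⁻¹, ?_, by simp⟩
    rw [inv_pow, ← Complex.ofReal_pow, Real.sq_sqrt (by norm_num)]
    norm_num
  obtain ⟨p, b⟩ := ω
  fin_cases p <;> cases b
  · refine ⟨![c, -c], fun q => ?_⟩
    fin_cases q <;> simp [pauli, blochVec, hs, Fin.sum_univ_two] <;> ring_nf <;> simp [hc]
  · refine ⟨![c, c], fun q => ?_⟩
    fin_cases q <;> simp [pauli, blochVec, hs, Fin.sum_univ_two] <;> ring_nf <;> simp [hc]
  · refine ⟨![c, -(Complex.I * c)], fun q => ?_⟩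
    fin_cases q <;> simp [pauli, blochVec, hs, Fin.sum_univ_two] <;> ring_nf <;>
      (simp [hc]; try norm_num)
  · refine ⟨![c, Complex.I * c], fun q => ?_⟩
    fin_cases q <;> simp [pauli, blochVec, hs, Fin.sum_univ_two] <;> ring_nf <;>
      (simp [hc]; try norm_num)
  · refine ⟨![0, 1], fun q => ?_⟩
    fin_cases q <;> simp [pauli, blochVec, Fin.sum_univ_two]
  · refine ⟨![1, 0], fun q => ?_⟩
    fin_cases q <;> simp [pauli, blochVec, Fin.sum_univ_two]

lemma norm_formEval_blochVec_le {n : ℕ} (a : (Fin n → Fin 4) → ℂ) (x : Fin n → Fin 3 × Bool) :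
    ‖formEval a fun j => blochVec (x j)‖ ≤
      ‖Matrix.toEuclideanCLM (𝕜 := ℂ) (∑ s : Fin n → Fin 4, a s • pauliTensor s)‖ := by
  choose ψ hψ using exists_state_blochVec
  set A := ∑ s : Fin n → Fin 4, a s • pauliTensor s with hA
  set v : EuclideanSpace ℂ (Fin n → Fin 2) := WithLp.toLp 2 fun y => ∏ j, ψ (x j) (y j) with hv
  have key : ∀ s : Fin n → Fin 4, ∑ y, ∑ z, star (v y) * pauliTensor s y z * v z =
      ∏ j, blochVec (x j) (s j) := by
    intro s
    simp_rw [← hψ, Finset.prod_univ_sum, Fintype.piFinset_univ]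
    refine Finset.sum_congr rfl fun y _ => Finset.sum_congr rfl fun z _ => ?_
    simp [hv, pauliTensor, Finset.prod_mul_distrib]
  have hinner : inner ℂ v (Matrix.toEuclideanCLM (𝕜 := ℂ) A v) =
      formEval a fun j => blochVec (x j) := by
    have : inner ℂ v (Matrix.toEuclideanCLM (𝕜 := ℂ) A v) =
        ∑ y, ∑ z, star (v y) * A y z * v z := by
      simp [PiLp.inner_apply, Matrix.mulVec, dotProduct, Finset.mul_sum, mul_comm, mul_left_comm]
    rw [this, formEval]
    simp_rw [← key, hA, Matrix.sum_apply, Finset.mul_sum, Finset.sum_mul]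
    rw [Finset.sum_comm_cycle]
    simp [mul_assoc, mul_comm, mul_left_comm]
  have hnorm : ‖v‖ = 1 := by
    have h0 := key 0
    have h1 : ∑ y, ∑ z, star (v y) * pauliTensor (0 : Fin n → Fin 4) y z * v z = inner ℂ v v := by
      have h2 : ∀ y z, pauliTensor (0 : Fin n → Fin 4) y z = if y = z then 1 else 0 := by
        intro y z
        have h3 : ∀ u w : Fin 2, pauli 0 u w = if u = w then 1 else 0 := by
          intro u w
          fin_cases u <;> fin_cases w <;> simp [pauli]
        simp [pauliTensor, h3, Finset.prod_ite_zero, funext_iff]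
      rw [PiLp.inner_apply]
      simp [h2, mul_comm, -inner_self_eq_norm_sq_to_K]
    rw [h1, inner_self_eq_norm_sq_to_K] at h0
    simp only [Pi.zero_apply, blochVec, if_true, Finset.prod_const_one] at h0
    have h4 : ((‖v‖ ^ 2 : ℝ) : ℂ) = (1 : ℝ) := by simpa using h0
    exact (pow_eq_one_iff_of_nonneg (norm_nonneg v) two_ne_zero).1 (Complex.ofReal_injective h4)
  calc _ = ‖inner ℂ v (Matrix.toEuclideanCLM (𝕜 := ℂ) A v)‖ := by rw [hinner]
    _ ≤ ‖v‖ * ‖Matrix.toEuclideanCLM (𝕜 := ℂ) A v‖ := norm_inner_le_norm _ _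
    _ ≤ ‖v‖ * (‖Matrix.toEuclideanCLM (𝕜 := ℂ) A‖ * ‖v‖) := by
      gcongr
      exact ContinuousLinearMap.le_opNorm _ _
    _ = _ := by rw [hnorm]; ring

lemma formEval_cons {n : ℕ} (a : (Fin (n + 1) → Fin 4) → ℂ) (y : Fin 4 → ℂ)
    (Y : Fin n → Fin 4 → ℂ) :
    formEval a (Fin.cons y Y) = ∑ q, y q * formEval (fun s => a (Fin.cons q s)) Y := by
  unfold formEval
  rw [← (Fin.consEquiv fun _ => Fin 4).sum_comp, Fintype.sum_prod_type]
  refine Finset.sum_congr rfl fun q _ => ?_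
  rw [Finset.mul_sum]
  refine Finset.sum_congr rfl fun s _ => ?_
  simp [Fin.consEquiv, Fin.prod_univ_succ]
  ring

lemma sum_fin_succ_fun {n : ℕ} {α M : Type*} [Fintype α] [AddCommMonoid M]
    (f : (Fin (n + 1) → α) → M) : ∑ x, f x = ∑ q, ∑ x, f (Fin.cons q x) := by
  rw [← (Fin.consEquiv fun _ => α).sum_comp, Fintype.sum_prod_type]
  rfl

lemma sum_blochVec_sq (z : Fin 4 → ℂ) :
    ∑ ω, ‖∑ q, blochVec ω q * z q‖ ^ 2 = 6 * ∑ q, (if q = 0 then 1 else 1 / 3) * ‖z q‖ ^ 2 := by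
  simp [Fintype.sum_prod_type, Fin.sum_univ_succ, blochVec, Complex.sq_norm, Complex.normSq_apply]
  ring

lemma sum_blochVec_pow_four_le (z : Fin 4 → ℂ) :
    ∑ ω, ‖∑ q, blochVec ω q * z q‖ ^ 4 ≤ 6 * (∑ q, ‖z q‖ ^ 2) ^ 2 := by
  have h4 : ∀ w : ℂ, ‖w‖ ^ 4 = (w.re * w.re + w.im * w.im) ^ 2 := fun w => by
    rw [← Complex.normSq_apply, ← Complex.sq_norm]; ring
  simp only [h4, Complex.sq_norm, Complex.normSq_apply]
  simp [Fintype.sum_prod_type, Fin.sum_univ_succ, blochVec]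
  set h : Fin 4 → ℝ := fun q => (z q).re * (z q).re + (z q).im * (z q).im with hh
  have h0 : ∀ q, 0 ≤ h q := fun q =>
    add_nonneg (mul_self_nonneg _) (mul_self_nonneg _)
  have him : ∀ q, 0 ≤ ((z 0).re * (z q).im - (z 0).im * (z q).re) ^ 2 := fun q => sq_nonneg _
  have hmul : ∀ q r, 0 ≤ h q * h r := fun q r => mul_nonneg (h0 q) (h0 r)
  have e1 := hmul 1 1
  have e2 := hmul 2 2
  have e3 := hmul 3 3
  have e4 := hmul 1 2
  have e5 := hmul 1 3
  have e6 := hmul 2 3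
  simp only [hh] at e1 e2 e3 e4 e5 e6
  have e7 := him 1
  have e8 := him 2
  have e9 := him 3
  linarith only [e1, e2, e3, e4, e5, e6, e7, e8, e9]

/-- The `L²` identity for forms evaluated at independent uniform Bloch vectors. -/
lemma sum_norm_formEval_sq {n : ℕ} (a : (Fin n → Fin 4) → ℂ) :
    ∑ x : Fin n → Fin 3 × Bool, ‖formEval a fun j => blochVec (x j)‖ ^ 2 =
      6 ^ n * ∑ s, (∏ j, if s j = 0 then (1 : ℝ) else 1 / 3) * ‖a s‖ ^ 2 := by
  induction n with
  | zero => simp [formEval]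
  | succ n ih =>
    have hc : ∀ (ω : Fin 3 × Bool) (x : Fin n → Fin 3 × Bool),
        (fun j => blochVec ((Fin.cons ω x : Fin (n + 1) → Fin 3 × Bool) j)) =
          Fin.cons (blochVec ω) fun j => blochVec (x j) := fun ω x => by
      ext j; refine Fin.cases ?_ (fun i => ?_) j <;> simp
    rw [sum_fin_succ_fun, sum_fin_succ_fun, Finset.sum_comm]
    simp_rw [hc, formEval_cons, sum_blochVec_sq]
    rw [← Finset.mul_sum, Finset.sum_comm]
    simp_rw [← Finset.mul_sum, ih, Fin.prod_univ_succ, Fin.cons_zero, Fin.cons_succ, mul_assoc,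
      ← Finset.mul_sum, pow_succ']
    simp only [Finset.mul_sum]
    refine Finset.sum_congr rfl fun q _ => Finset.sum_congr rfl fun s _ => ?_
    ring

/-- Hypercontractive estimate: the fourth moment of a form evaluated at independent uniform
Bloch vectors is controlled by the `ℓ²` norm of its coefficients. -/
lemma sum_norm_formEval_pow_four_le {n : ℕ} (a : (Fin n → Fin 4) → ℂ) :
    ∑ x : Fin n → Fin 3 × Bool, ‖formEval a fun j => blochVec (x j)‖ ^ 4 ≤
      6 ^ n * (∑ s, ‖a s‖ ^ 2) ^ 2 := by
  induction n with
  | zero => simp [formEval]; ring_nf; rfl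
  | succ n ih =>
    have hc : ∀ (ω : Fin 3 × Bool) (x : Fin n → Fin 3 × Bool),
        (fun j => blochVec ((Fin.cons ω x : Fin (n + 1) → Fin 3 × Bool) j)) =
          Fin.cons (blochVec ω) fun j => blochVec (x j) := fun ω x => by
      ext j; refine Fin.cases ?_ (fun i => ?_) j <;> simp
    rw [sum_fin_succ_fun, Finset.sum_comm]
    simp_rw [hc, formEval_cons]
    set F : Fin 4 → (Fin n → Fin 3 × Bool) → ℝ := fun q x =>
      ‖formEval (fun s => a (Fin.cons q s)) fun j => blochVec (x j)‖ ^ 2 with hF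
    set B : Fin 4 → ℝ := fun q => ∑ s, ‖a (Fin.cons q s)‖ ^ 2 with hB
    have hB0 : ∀ q, 0 ≤ B q := fun q => Finset.sum_nonneg fun _ _ => by positivity
    have hFB : ∀ q, ∑ x, F q x ^ 2 ≤ 6 ^ n * B q ^ 2 := fun q => by
      simpa only [hF, ← pow_mul] using ih fun s => a (Fin.cons q s)
    have hcs : ∀ q r, ∑ x, F q x * F r x ≤ 6 ^ n * (B q * B r) := fun q r => by
      refine abs_le_of_sq_le_sq' ?_ (mul_nonneg (by positivity) (mul_nonneg (hB0 q) (hB0 r))) |>.2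
      calc _ ≤ (∑ x, F q x ^ 2) * ∑ x, F r x ^ 2 := Finset.sum_mul_sq_le_sq_mul_sq _ _ _
        _ ≤ (6 ^ n * B q ^ 2) * (6 ^ n * B r ^ 2) := by
          gcongr
          · exact hFB q
          · exact hFB r
        _ = _ := by ring
    calc _ ≤ ∑ x, 6 * (∑ q, F q x) ^ 2 := Finset.sum_le_sum fun x _ => sum_blochVec_pow_four_le _
      _ = 6 * ∑ q, ∑ r, ∑ x, F q x * F r x := by
        rw [← Finset.mul_sum, Finset.sum_comm_cycle]
        simp_rw [sq, Finset.sum_mul_sum]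
      _ ≤ 6 * ∑ q, ∑ r, 6 ^ n * (B q * B r) := by
        gcongr
        exact hcs _ _
      _ = 6 ^ (n + 1) * (∑ s, ‖a s‖ ^ 2) ^ 2 := by
        rw [sum_fin_succ_fun, sq (∑ q, _), Finset.sum_mul_sum, pow_succ']
        simp_rw [← Finset.mul_sum, mul_assoc]
        simp [hB]

/-- Khinchine-type inequality for forms of degree at most `d` at independent Bloch vectors. -/
lemma sqrt_sum_sq_le_of_degree_le {n d : ℕ} (a : (Fin n → Fin 4) → ℂ)
    (ha : ∀ s : Fin n → Fin 4, d < (Finset.univ.filter (fun j => s j ≠ 0)).card → a s = 0) :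
    √(∑ s, ‖a s‖ ^ 2) ≤
      6 ^ d * ((6 ^ n)⁻¹ * ∑ x : Fin n → Fin 3 × Bool, ‖formEval a fun j => blochVec (x j)‖) := by
  set f : (Fin n → Fin 3 × Bool) → ℝ := fun x => ‖formEval a fun j => blochVec (x j)‖ with hf
  have hf0 : ∀ x, 0 ≤ f x := fun x => norm_nonneg _
  set B := ∑ s, ‖a s‖ ^ 2 with hB
  have hB0 : 0 ≤ B := Finset.sum_nonneg fun _ _ => by positivity
  set S₁ := ∑ x, f x with hS₁
  set S₂ := ∑ x, f x ^ 2 with hS₂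
  set S₃ := ∑ x, f x ^ 3 with hS₃
  set S₄ := ∑ x, f x ^ 4 with hS₄
  have hS₁0 : 0 ≤ S₁ := Finset.sum_nonneg fun x _ => hf0 x
  have hS₂0 : 0 ≤ S₂ := Finset.sum_nonneg fun x _ => by positivity
  have h4 : S₄ ≤ 6 ^ n * B ^ 2 := sum_norm_formEval_pow_four_le a
  have h2 : 6 ^ n * ((1 / 3) ^ d * B) ≤ S₂ := by
    rw [hS₂, sum_norm_formEval_sq, hB, Finset.mul_sum]
    refine mul_le_mul_of_nonneg_left (Finset.sum_le_sum fun s _ => ?_) (by positivity)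
    by_cases hs : d < (Finset.univ.filter (fun j => s j ≠ 0)).card
    · simp [ha s hs]
    · gcongr
      rw [Finset.prod_ite]
      simp only [Finset.prod_const, one_pow, one_mul]
      exact pow_le_pow_of_le_one (by norm_num) (by norm_num) (not_lt.1 hs)
  have h13 : S₂ ^ 2 ≤ S₁ * S₃ := by
    have := Finset.sum_mul_sq_le_sq_mul_sq Finset.univ (fun x => √(f x)) (fun x => √(f x) ^ 3)
    refine (le_of_eq ?_).trans (this.trans (le_of_eq ?_))
    · congr 1
      refine Finset.sum_congr rfl fun x _ => ?_
      rw [← pow_succ', show 3 + 1 = 2 * 2 by rfl, pow_mul, Real.sq_sqrt (hf0 x)]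
    · congr 1 <;> refine Finset.sum_congr rfl fun x _ => ?_
      · exact Real.sq_sqrt (hf0 x)
      · rw [← pow_mul, mul_comm, pow_mul, Real.sq_sqrt (hf0 x)]
  have h24 : S₃ ^ 2 ≤ S₂ * S₄ := by
    have := Finset.sum_mul_sq_le_sq_mul_sq Finset.univ f (fun x => f x ^ 2)
    simpa only [← pow_succ', ← pow_mul] using this
  have h5 : S₂ ^ 3 ≤ S₁ ^ 2 * S₄ := by
    rcases hS₂0.eq_or_lt with h | h
    · rw [← h]
      have : 0 ≤ S₄ := Finset.sum_nonneg fun x _ => by positivity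
      simpa using mul_nonneg (sq_nonneg S₁) this
    · refine le_of_mul_le_mul_left ?_ h
      calc S₂ * S₂ ^ 3 = (S₂ ^ 2) ^ 2 := by ring
        _ ≤ (S₁ * S₃) ^ 2 := by gcongr
        _ = S₁ ^ 2 * S₃ ^ 2 := by ring
        _ ≤ S₁ ^ 2 * (S₂ * S₄) := by gcongr
        _ = _ := by ring
  rcases hB0.eq_or_lt with h | h
  · rw [← h]
    simp only [Real.sqrt_zero]
    positivity
  refine Real.sqrt_le_iff.2 ⟨by positivity, ?_⟩
  have h6 : (6 ^ n * ((1 / 3) ^ d * B)) ^ 3 ≤ S₁ ^ 2 * (6 ^ n * B ^ 2) :=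
    (pow_le_pow_left₀ (by positivity) h2 3).trans (h5.trans (by gcongr))
  have h7 : ((6 : ℝ) ^ n) ^ 2 * ((1 / 27) ^ d * B) ≤ S₁ ^ 2 := by
    refine le_of_mul_le_mul_right ?_ (show 0 < (6 : ℝ) ^ n * B ^ 2 by positivity)
    refine le_trans (le_of_eq ?_) h6
    have : (1 / 27 : ℝ) ^ d = ((1 / 3) ^ d) ^ 3 := by
      rw [← pow_mul, mul_comm, pow_mul]
      norm_num
    rw [this]
    ring
  calc B = 27 ^ d * (((6 : ℝ) ^ n)⁻¹ ^ 2 * (((6 : ℝ) ^ n) ^ 2 * ((1 / 27) ^ d * B))) := by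
        have : (27 : ℝ) ^ d * (1 / 27) ^ d = 1 := by rw [← mul_pow]; norm_num
        field_simp
        linear_combination -this
    _ ≤ 36 ^ d * (((6 : ℝ) ^ n)⁻¹ ^ 2 * S₁ ^ 2) := by
        gcongr
        norm_num
    _ = _ := by
        rw [show (36 : ℝ) = 6 ^ 2 by norm_num, ← pow_mul, mul_comm 2 d, pow_mul]
        ring

/-- A multilinear form bounded at extreme points is bounded on products of their convex hulls. -/
lemma norm_formEval_le_of_convex {n : ℕ} {a : (Fin n → Fin 4) → ℂ} {M : ℝ}
    (hM : ∀ x : Fin n → Fin 3 × Bool, ‖formEval a fun j => blochVec (x j)‖ ≤ M)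
    (l : Fin n → Fin 3 × Bool → ℝ) (hl : ∀ j ω, 0 ≤ l j ω) (hl1 : ∀ j, ∑ ω, l j ω = 1) :
    ‖formEval a fun j q => ∑ ω, (l j ω : ℂ) * blochVec ω q‖ ≤ M := by
  have h : (formEval a fun j q => ∑ ω, (l j ω : ℂ) * blochVec ω q) =
      ∑ x : Fin n → Fin 3 × Bool, ((∏ j, l j (x j) : ℝ) : ℂ) *
        formEval a fun j => blochVec (x j) := by
    simp_rw [formEval, Finset.prod_univ_sum, Fintype.piFinset_univ, Finset.mul_sum]
    rw [Finset.sum_comm]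
    refine Finset.sum_congr rfl fun x _ => Finset.sum_congr rfl fun s _ => ?_
    rw [Finset.prod_mul_distrib]
    push_cast
    ring
  have h1 : ∑ x : Fin n → Fin 3 × Bool, ∏ j, l j (x j) = 1 := by
    have := Finset.prod_univ_sum (fun _ : Fin n => (Finset.univ : Finset (Fin 3 × Bool))) l
    simp_rw [hl1, Fintype.piFinset_univ] at this
    simpa using this.symm
  rw [h]
  calc _ ≤ ∑ x : Fin n → Fin 3 × Bool, (∏ j, l j (x j)) * M := by
        refine norm_sum_le_of_le _ fun x _ => ?_
        have h0 : 0 ≤ ∏ j, l j (x j) := Finset.prod_nonneg fun j _ => hl _ _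
        rw [norm_mul, Complex.norm_real, Real.norm_of_nonneg h0]
        exact mul_le_mul_of_nonneg_left (hM x) h0
    _ = M := by rw [← Finset.sum_mul, h1, one_mul]

/-- The linear coefficient of a polynomial of degree at most `d` is controlled by its values on
`[-1, 1]`. -/
lemma exists_norm_coeff_one_le (d : ℕ) :
    ∃ C : ℝ, 0 ≤ C ∧ ∀ (P : Polynomial ℂ) (M : ℝ), P.natDegree ≤ d →
      (∀ t : ℝ, |t| ≤ 1 → ‖P.eval (t : ℂ)‖ ≤ M) → ‖P.coeff 1‖ ≤ C * M := by
  set v : Fin (d + 1) → ℂ := fun i => (((i : ℕ) / (d + 1 : ℝ) : ℝ) : ℂ) with hv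
  have hinj : Set.InjOn v (Finset.univ : Finset (Fin (d + 1))) := by
    intro i _ j _ hij
    have hd : (d + 1 : ℝ) ≠ 0 := by positivity
    have := Complex.ofReal_injective hij
    rw [div_left_inj' hd] at this
    exact Fin.ext (by exact_mod_cast this)
  refine ⟨∑ i, ‖(Lagrange.basis Finset.univ v i).coeff 1‖,
    Finset.sum_nonneg fun _ _ => norm_nonneg _, fun P M hP hM => ?_⟩
  have hdeg : P.degree < (Finset.univ : Finset (Fin (d + 1))).card := by
    rw [Finset.card_univ, Fintype.card_fin]
    exact lt_of_le_of_lt (Polynomial.natDegree_le_iff_degree_le.1 hP) (by exact_mod_cast d.lt_succ_self)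
  have h := Lagrange.eq_interpolate hinj hdeg
  rw [h, Lagrange.interpolate_apply, Polynomial.finsetSum_coeff, Finset.sum_mul]
  refine norm_sum_le_of_le _ fun i _ => ?_
  rw [Polynomial.coeff_C_mul, norm_mul, mul_comm]
  gcongr
  refine hM _ ?_
  rw [abs_of_nonneg (by positivity), div_le_one (by positivity)]
  exact_mod_cast i.2.le

lemma coeff_one_prod_linear {ι : Type*} [DecidableEq ι] (T : Finset ι) (u v : ι → ℂ) :
    (∏ j ∈ T, (Polynomial.C (u j) + Polynomial.C (v j) * Polynomial.X)).coeff 1 =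
      ∑ j ∈ T, v j * ∏ i ∈ T.erase j, u i := by
  have h := Polynomial.coeff_derivative
    (∏ j ∈ T, (Polynomial.C (u j) + Polynomial.C (v j) * Polynomial.X)) 0
  simp only [zero_add, Nat.cast_zero, mul_one] at h
  rw [← h, Polynomial.coeff_zero_eq_eval_zero, Polynomial.derivative_prod_finset,
    Polynomial.eval_finsetSum]
  refine Finset.sum_congr rfl fun j _ => ?_
  rw [mul_comm]
  simp [Polynomial.eval_prod]

/-- The Bloch vector of an equal mixture of the state `ω` and the maximally mixed state. -/
noncomputable def halfBlochVec (ω : Fin 3 × Bool) (q : Fin 4) : ℂ :=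
  (if q = 0 then 1 else 1 / 2) * blochVec ω q

lemma sum_mixture_blochVec (ω₀ : Fin 3 × Bool) (p : Fin 3) (r : ℝ) (q : Fin 4) :
    ∑ ω : Fin 3 × Bool, (((if ω = ω₀ then 1 / 2 else 0) +
      if ω.1 = p then (if ω.2 then (1 + r) / 4 else (1 - r) / 4) else 0 : ℝ) : ℂ) * blochVec ω q =
      halfBlochVec ω₀ q + r * if q = p.succ then 1 / 2 else 0 := by
  have h1 : ∑ ω : Fin 3 × Bool, ((if ω = ω₀ then 1 / 2 else 0 : ℝ) : ℂ) * blochVec ω q =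
      1 / 2 * blochVec ω₀ q := by
    simp [apply_ite Complex.ofReal]
  have h2 : ∑ ω : Fin 3 × Bool, ((if ω.1 = p then
      (if ω.2 then (1 + r) / 4 else (1 - r) / 4) else 0 : ℝ) : ℂ) * blochVec ω q =
      (1 + r) / 4 * blochVec (p, true) q + (1 - r) / 4 * blochVec (p, false) q := by
    simp [Fintype.sum_prod_type, apply_ite Complex.ofReal]
  simp_rw [Complex.ofReal_add, add_mul, Finset.sum_add_distrib]
  rw [h1, h2]
  refine Fin.cases ?_ (fun k => ?_) q
  · simp [halfBlochVec, blochVec, (Fin.succ_ne_zero p).symm]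
    ring
  · by_cases hk : k = p
    · simp [halfBlochVec, blochVec, hk]
      ring
    · simp [halfBlochVec, blochVec, hk]

/-- Half the derivative of the form with coefficients `a` at the vectors `halfBlochVec (x i)` in
direction `p` at site `j`. -/
noncomputable def formDeriv {n : ℕ} (a : (Fin n → Fin 4) → ℂ) (x : Fin n → Fin 3 × Bool)
    (p : Fin 3) (j : Fin n) : ℂ :=
  ∑ s, a s * ((if s j = p.succ then 1 / 2 else 0) *
    ∏ i ∈ Finset.univ.erase j, halfBlochVec (x i) (s i))

lemma exists_norm_sum_formDeriv_le (d : ℕ) :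
    ∃ C : ℝ, 0 ≤ C ∧ ∀ (n : ℕ) (a : (Fin n → Fin 4) → ℂ) (M : ℝ),
      (∀ s : Fin n → Fin 4, d < (Finset.univ.filter (fun j => s j ≠ 0)).card → a s = 0) →
      (∀ x : Fin n → Fin 3 × Bool, ‖formEval a fun j => blochVec (x j)‖ ≤ M) →
      ∀ (x : Fin n → Fin 3 × Bool) (p : Fin 3) (ε : Fin n → ℝ), (∀ j, |ε j| ≤ 1) →
        ‖∑ j, (ε j : ℂ) * formDeriv a x p j‖ ≤ C * M := by
  obtain ⟨C, hC, h⟩ := exists_norm_coeff_one_le d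
  refine ⟨C, hC, fun n a M ha hM x p ε hε => ?_⟩
  set u : (Fin n → Fin 4) → Fin n → ℂ := fun s j => halfBlochVec (x j) (s j) with hu
  set v : (Fin n → Fin 4) → Fin n → ℂ := fun s j =>
    (ε j : ℂ) * if s j = p.succ then 1 / 2 else 0 with hv
  set P : Polynomial ℂ := ∑ s, Polynomial.C (a s) *
    ∏ j, (Polynomial.C (u s j) + Polynomial.C (v s j) * Polynomial.X) with hP
  have hcoeff : P.coeff 1 = ∑ j, (ε j : ℂ) * formDeriv a x p j := by
    simp_rw [hP, Polynomial.finsetSum_coeff, Polynomial.coeff_C_mul, coeff_one_prod_linear,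
      formDeriv, Finset.mul_sum]
    rw [Finset.sum_comm]
    refine Finset.sum_congr rfl fun j _ => Finset.sum_congr rfl fun s _ => ?_
    simp only [hu, hv]
    ring
  rw [← hcoeff]
  refine h P M ?_ fun t ht => ?_
  · refine Polynomial.natDegree_sum_le_of_forall_le _ _ fun s _ => ?_
    by_cases hs : d < (Finset.univ.filter (fun j => s j ≠ 0)).card
    · simp [ha s hs]
    refine (Polynomial.natDegree_C_mul_le _ _).trans ((Polynomial.natDegree_prod_le _ _).trans ?_)
    refine le_trans (Finset.sum_le_sum fun j _ => ?_)
      ((Finset.card_filter (fun j => s j ≠ 0) Finset.univ).symm.le.trans (not_lt.1 hs))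
    by_cases hj : s j = 0
    · simp [hv, hj, (Fin.succ_ne_zero p).symm]
    · rw [if_pos hj]
      compute_degree
  · set l : Fin n → Fin 3 × Bool → ℝ := fun j ω => (if ω = x j then 1 / 2 else 0) +
      if ω.1 = p then (if ω.2 then (1 + t * ε j) / 4 else (1 - t * ε j) / 4) else 0 with hl
    have hb : ∀ j, |t * ε j| ≤ 1 := fun j => by
      rw [abs_mul]
      exact mul_le_one₀ ht (abs_nonneg _) (hε j)
    have hl0 : ∀ j ω, 0 ≤ l j ω := fun j ω => by
      have := abs_le.1 (hb j)
      refine add_nonneg (by split_ifs <;> norm_num) ?_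
      split_ifs <;> linarith
    have hl1 : ∀ j, ∑ ω, l j ω = 1 := fun j => by
      simp only [hl, Finset.sum_add_distrib, Finset.sum_ite_eq', Finset.mem_univ, if_true]
      simp [Fintype.sum_prod_type]
      ring
    refine (le_of_eq ?_).trans (norm_formEval_le_of_convex hM l hl0 hl1)
    congr 1
    simp only [hP, Polynomial.eval_finsetSum, Polynomial.eval_mul, Polynomial.eval_C,
      Polynomial.eval_prod, Polynomial.eval_add, Polynomial.eval_X, formEval]
    refine Finset.sum_congr rfl fun s _ => ?_
    congr 1
    refine Finset.prod_congr rfl fun j _ => ?_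
    have := sum_mixture_blochVec (x j) p (t * ε j) (s j)
    simp only [hl, hu, hv, this]
    push_cast
    ring

lemma exists_sum_norm_formDeriv_le (d : ℕ) :
    ∃ C : ℝ, 0 ≤ C ∧ ∀ (n : ℕ) (a : (Fin n → Fin 4) → ℂ) (M : ℝ),
      (∀ s : Fin n → Fin 4, d < (Finset.univ.filter (fun j => s j ≠ 0)).card → a s = 0) →
      (∀ x : Fin n → Fin 3 × Bool, ‖formEval a fun j => blochVec (x j)‖ ≤ M) →
      ∀ (x : Fin n → Fin 3 × Bool) (p : Fin 3), ∑ j, ‖formDeriv a x p j‖ ≤ C * M := by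
  obtain ⟨C, hC, h⟩ := exists_norm_sum_formDeriv_le d
  refine ⟨2 * C, by positivity, fun n a M ha hM x p => ?_⟩
  have hsign : ∀ r : ℝ, |(SignType.sign r : ℝ)| ≤ 1 := fun r => by
    rcases lt_trichotomy r 0 with hr | hr | hr <;> simp [hr]
  have hre : ∑ j, |(formDeriv a x p j).re| ≤ C * M := by
    refine le_trans ?_ (h n a M ha hM x p (fun j => SignType.sign (formDeriv a x p j).re)
      fun j => hsign _)
    refine le_trans (le_of_eq ?_) ((le_abs_self _).trans (Complex.abs_re_le_norm _))
    simp_rw [Complex.re_sum, Complex.re_ofReal_mul, sign_mul_self]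
  have him : ∑ j, |(formDeriv a x p j).im| ≤ C * M := by
    refine le_trans ?_ (h n a M ha hM x p (fun j => SignType.sign (formDeriv a x p j).im)
      fun j => hsign _)
    refine le_trans (le_of_eq ?_) ((le_abs_self _).trans (Complex.abs_im_le_norm _))
    simp_rw [Complex.im_sum, Complex.im_ofReal_mul, sign_mul_self]
  calc _ ≤ ∑ j, (|(formDeriv a x p j).re| + |(formDeriv a x p j).im|) :=
        Finset.sum_le_sum fun j _ => Complex.norm_le_abs_re_add_abs_im _
    _ ≤ _ := by
        rw [Finset.sum_add_distrib]
        linarith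

lemma rpow_le_sum_add_prod {ι : Type*} {T : Finset ι} {d : ℕ} (hT : T.card ≤ d) {b : ℝ}
    (hb : 0 < b) (hb1 : b ≤ 1) {r : ι → ℝ} (hr : ∀ j ∈ T, 0 < r j) :
    b ^ (2 * (d : ℝ) / (d + 1)) ≤ ∑ j ∈ T, b ^ 2 / r j + ∏ j ∈ T, r j := by
  set k := T.card with hk
  set S := ∑ j ∈ T, b ^ 2 / r j + ∏ j ∈ T, r j with hS
  have hterm : ∀ j ∈ T, 0 ≤ b ^ 2 / r j := fun j hj => div_nonneg (sq_nonneg b) (hr j hj).le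
  have hsum0 : 0 ≤ ∑ j ∈ T, b ^ 2 / r j := Finset.sum_nonneg hterm
  have hprod0 : 0 < ∏ j ∈ T, r j := Finset.prod_pos hr
  have hS0 : 0 ≤ S := by positivity
  have hpow : (b ^ 2) ^ k ≤ S ^ (k + 1) := by
    calc (b ^ 2) ^ k = (∏ j ∈ T, b ^ 2 / r j) * ∏ j ∈ T, r j := by
          rw [← Finset.prod_mul_distrib, hk, ← Finset.prod_const]
          exact Finset.prod_congr rfl fun j hj => (div_mul_cancel₀ _ (hr j hj).ne').symm
      _ ≤ S ^ k * S := by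
          gcongr
          · rw [hk, ← Finset.prod_const]
            refine Finset.prod_le_prod hterm fun j hj => ?_
            exact (Finset.single_le_sum hterm hj).trans (le_add_of_nonneg_right hprod0.le)
          · exact le_add_of_nonneg_left hsum0
      _ = S ^ (k + 1) := (pow_succ _ _).symm
  calc b ^ (2 * (d : ℝ) / (d + 1)) ≤ b ^ (2 * (k : ℝ) / (k + 1)) := by
        refine Real.rpow_le_rpow_of_exponent_ge hb hb1 ?_
        rw [div_le_div_iff₀ (by positivity) (by positivity)]
        have : (k : ℝ) ≤ d := by exact_mod_cast hT
        nlinarith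
    _ = ((b ^ 2) ^ k) ^ ((k + 1 : ℝ)⁻¹) := by
        rw [← pow_mul, ← Real.rpow_natCast, ← Real.rpow_mul hb.le]
        push_cast
        rw [div_eq_mul_inv]
    _ ≤ (S ^ (k + 1)) ^ ((k + 1 : ℝ)⁻¹) := by gcongr
    _ = S := by
        rw [← Real.rpow_natCast, ← Real.rpow_mul hS0]
        push_cast
        rw [mul_inv_cancel₀ (by positivity), Real.rpow_one]

/-- A Blei-type inequality: `ℓ^{2d/(d+1)}` sums are controlled by mixed `ℓ¹(ℓ²)` norms. -/
lemma sum_rpow_le_four {n d : ℕ} (hd : 1 ≤ d) (b : (Fin n → Fin 4) → ℝ) (R : Fin n → Fin 4 → ℝ)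
    (hb0 : ∀ s, 0 ≤ b s) (hb1 : ∀ s, b s ≤ 1)
    (hdeg : ∀ s : Fin n → Fin 4, d < (Finset.univ.filter (fun j => s j ≠ 0)).card → b s = 0)
    (hR0 : ∀ j q, 0 ≤ R j q)
    (hbR : ∀ j (p : Fin 3), ∑ s, (if s j = p.succ then b s ^ 2 else 0) ≤ R j p.succ ^ 2)
    (hR : ∑ j, ∑ p : Fin 3, R j p.succ ≤ 1) :
    ∑ s, b s ^ (2 * (d : ℝ) / (d + 1)) ≤ 4 := by
  have hpt : ∀ s, b s ^ (2 * (d : ℝ) / (d + 1)) ≤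
      ∑ j, (if s j = 0 then 0 else b s ^ 2 / R j (s j)) +
        ∏ j, (if s j = 0 then 1 else R j (s j)) := by
    intro s
    rcases (hb0 s).eq_or_lt with h | h
    · rw [← h, Real.zero_rpow (by positivity)]
      refine add_nonneg (Finset.sum_nonneg fun j _ => ?_) (Finset.prod_nonneg fun j _ => ?_)
      · split_ifs <;> simp
      · split_ifs
        · exact zero_le_one
        · exact hR0 _ _
    · have hcard : (Finset.univ.filter (fun j => s j ≠ 0)).card ≤ d := by
        by_contra hc
        exact h.ne' (hdeg s (not_le.1 hc))
      refine (rpow_le_sum_add_prod (r := fun j => R j (s j)) hcard h (hb1 s) ?_).trans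
        (le_of_eq ?_)
      · intro j hj
        obtain ⟨p, hp⟩ := Fin.exists_succ_eq.2 (Finset.mem_filter.1 hj).2
        have h1 := hbR j p
        have h2 : b s ^ 2 ≤ R j p.succ ^ 2 := by
          refine le_trans ?_ h1
          refine le_trans (le_of_eq ?_) (Finset.single_le_sum (f := fun s : Fin n → Fin 4 =>
            if s j = p.succ then b s ^ 2 else 0) (fun s _ => ?_) (Finset.mem_univ s))
          · simp [hp]
          · split_ifs <;> positivity
        rw [← hp]
        exact h.trans_le (abs_le_of_sq_le_sq' h2 (hR0 _ _)).2
      · simp only [Finset.sum_filter, Finset.prod_filter, ne_eq, ite_not]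
  have hfirst : ∑ s : Fin n → Fin 4, ∑ j, (if s j = 0 then 0 else b s ^ 2 / R j (s j)) ≤ 1 := by
    rw [Finset.sum_comm]
    refine le_trans (Finset.sum_le_sum fun j _ => ?_) hR
    calc _ = ∑ s : Fin n → Fin 4, ∑ p : Fin 3,
          (if s j = p.succ then b s ^ 2 else 0) / R j p.succ := by
          refine Finset.sum_congr rfl fun s _ => ?_
          generalize s j = q
          refine Fin.cases ?_ (fun r => ?_) q
          · simp [(Fin.succ_ne_zero _).symm]
          · simp [ite_div]
      _ = ∑ p : Fin 3, (∑ s : Fin n → Fin 4, if s j = p.succ then b s ^ 2 else 0) /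
            R j p.succ := by
          rw [Finset.sum_comm]
          simp_rw [Finset.sum_div]
      _ ≤ _ := by
          refine Finset.sum_le_sum fun p _ => ?_
          refine div_le_of_le_mul₀ (hR0 _ _) (hR0 _ _) ?_
          rw [← sq]
          exact hbR j p
  have hsecond : ∑ s : Fin n → Fin 4, ∏ j, (if s j = 0 then 1 else R j (s j)) ≤ 3 := by
    have := Finset.prod_univ_sum (fun _ : Fin n => (Finset.univ : Finset (Fin 4)))
      fun j q => if q = 0 then 1 else R j q
    rw [Fintype.piFinset_univ] at this
    rw [← this]
    calc _ = ∏ j, (∑ p : Fin 3, R j p.succ + 1) := by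
          refine Finset.prod_congr rfl fun j _ => ?_
          rw [Fin.sum_univ_succ, add_comm]
          simp
      _ ≤ ∏ j, Real.exp (∑ p : Fin 3, R j p.succ) := by
          refine Finset.prod_le_prod (fun j _ => ?_) fun j _ => Real.add_one_le_exp _
          exact add_nonneg (Finset.sum_nonneg fun _ _ => hR0 _ _) zero_le_one
      _ = Real.exp (∑ j, ∑ p : Fin 3, R j p.succ) := (Real.exp_sum _ _).symm
      _ ≤ Real.exp 1 := Real.exp_le_exp.2 hR
      _ ≤ 3 := by linarith [Real.exp_one_lt_d9]
  calc _ ≤ _ := Finset.sum_le_sum fun s _ => hpt s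
    _ ≤ 4 := by
      rw [Finset.sum_add_distrib]
      linarith

lemma sqrt_sum_sq_le_formDeriv {n d : ℕ} (a : (Fin n → Fin 4) → ℂ)
    (ha : ∀ s : Fin n → Fin 4, d < (Finset.univ.filter (fun j => s j ≠ 0)).card → a s = 0)
    (j : Fin n) (p : Fin 3) :
    √(∑ s, if s j = p.succ then ‖a s‖ ^ 2 else 0) ≤
      12 ^ d * ((6 ^ n)⁻¹ * ∑ x : Fin n → Fin 3 × Bool, ‖formDeriv a x p j‖) := by
  set w : (Fin n → Fin 4) → ℝ := fun s => ∏ i, if s i = 0 then 1 else 1 / 2 with hw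
  set b : (Fin n → Fin 4) → ℂ := fun s => if s j = p.succ then a s * (w s : ℂ) else 0 with hb
  have hbdeg : ∀ s : Fin n → Fin 4, d < (Finset.univ.filter (fun j => s j ≠ 0)).card → b s = 0 :=
    fun s hs => by simp [hb, ha s hs]
  have hform : ∀ x : Fin n → Fin 3 × Bool,
      (formEval b fun i => blochVec (x i)) = blochVec (x j) p.succ * formDeriv a x p j := by
    intro x
    simp only [formEval, formDeriv, Finset.mul_sum]
    refine Finset.sum_congr rfl fun s _ => ?_
    by_cases hs : s j = p.succ
    · have hwc : (w s : ℂ) = ∏ i, if s i = 0 then 1 else 1 / 2 := by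
        simp [hw, apply_ite Complex.ofReal]
      simp only [hb, hwc, hs, if_true, halfBlochVec]
      rw [Finset.prod_mul_distrib, ← Finset.mul_prod_erase _ _ (Finset.mem_univ j),
        ← Finset.mul_prod_erase _ (fun i => blochVec (x i) (s i)) (Finset.mem_univ j)]
      simp only [hs, Fin.succ_ne_zero, if_false]
      ring
    · simp [hb, hs]
  have hbloch : ∀ ω : Fin 3 × Bool, ‖blochVec ω p.succ‖ ≤ 1 := fun ω => by
    unfold blochVec
    split_ifs <;> simp
  have hlow : (1 / 4) ^ d * ∑ s, (if s j = p.succ then ‖a s‖ ^ 2 else 0) ≤ ∑ s, ‖b s‖ ^ 2 := by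
    rw [Finset.mul_sum]
    refine Finset.sum_le_sum fun s _ => ?_
    by_cases hs : s j = p.succ
    · by_cases hd : d < (Finset.univ.filter (fun j => s j ≠ 0)).card
      · simp [hb, ha s hd]
      · simp only [hb, hs, if_true, norm_mul, mul_pow, Complex.norm_real, Real.norm_eq_abs, sq_abs]
        rw [mul_comm]
        refine mul_le_mul_of_nonneg_left ?_ (by positivity)
        simp only [hw]
        rw [Finset.prod_ite]
        simp only [Finset.prod_const, one_pow, one_mul]
        rw [← pow_mul, mul_comm, pow_mul]
        norm_num only
        exact pow_le_pow_of_le_one (by norm_num) (by norm_num) (not_lt.1 hd)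
    · simp [hb, hs]
  have hsqrt : (1 / 2) ^ d * √(∑ s, if s j = p.succ then ‖a s‖ ^ 2 else 0) ≤
      √(∑ s, ‖b s‖ ^ 2) := by
    refine le_trans (le_of_eq ?_) (Real.sqrt_le_sqrt hlow)
    rw [Real.sqrt_mul (by positivity), show (1 / 4 : ℝ) ^ d = ((1 / 2) ^ d) ^ 2 by
      rw [← pow_mul, mul_comm, pow_mul]; norm_num, Real.sqrt_sq (by positivity)]
  have hkh := sqrt_sum_sq_le_of_degree_le b hbdeg
  have hmono : ∑ x : Fin n → Fin 3 × Bool, ‖formEval b fun i => blochVec (x i)‖ ≤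
      ∑ x : Fin n → Fin 3 × Bool, ‖formDeriv a x p j‖ := by
    refine Finset.sum_le_sum fun x _ => ?_
    rw [hform, norm_mul]
    exact mul_le_of_le_one_left (norm_nonneg _) (hbloch _)
  have h2 : (2 : ℝ) ^ d * (1 / 2) ^ d = 1 := by rw [← mul_pow]; norm_num
  calc √(∑ s, if s j = p.succ then ‖a s‖ ^ 2 else 0)
      = 2 ^ d * ((1 / 2) ^ d * √(∑ s, if s j = p.succ then ‖a s‖ ^ 2 else 0)) := by
        rw [← mul_assoc, h2, one_mul]
    _ ≤ 2 ^ d * (6 ^ d * ((6 ^ n)⁻¹ *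
          ∑ x : Fin n → Fin 3 × Bool, ‖formDeriv a x p j‖)) := by
        refine mul_le_mul_of_nonneg_left (hsqrt.trans (hkh.trans ?_)) (by positivity)
        gcongr
    _ = _ := by
        rw [← mul_assoc, ← mul_pow]
        norm_num

lemma exists_sum_sqrt_le (d : ℕ) :
    ∃ C : ℝ, 0 ≤ C ∧ ∀ (n : ℕ) (a : (Fin n → Fin 4) → ℂ) (M : ℝ),
      (∀ s : Fin n → Fin 4, d < (Finset.univ.filter (fun j => s j ≠ 0)).card → a s = 0) →
      (∀ x : Fin n → Fin 3 × Bool, ‖formEval a fun j => blochVec (x j)‖ ≤ M) →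
      ∑ j, ∑ p : Fin 3, √(∑ s, if s j = p.succ then ‖a s‖ ^ 2 else 0) ≤ C * M := by
  obtain ⟨C, hC, h⟩ := exists_sum_norm_formDeriv_le d
  refine ⟨12 ^ d * (3 * C), by positivity, fun n a M ha hM => ?_⟩
  calc _ ≤ ∑ j, ∑ p : Fin 3,
        12 ^ d * ((6 ^ n)⁻¹ * ∑ x : Fin n → Fin 3 × Bool, ‖formDeriv a x p j‖) :=
        Finset.sum_le_sum fun j _ => Finset.sum_le_sum fun p _ => sqrt_sum_sq_le_formDeriv a ha j p
    _ = 12 ^ d * ((6 ^ n)⁻¹ *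
          ∑ p : Fin 3, ∑ x : Fin n → Fin 3 × Bool, ∑ j, ‖formDeriv a x p j‖) := by
        simp_rw [← Finset.mul_sum]
        congr 2
        rw [Finset.sum_comm]
        exact Finset.sum_congr rfl fun p _ => Finset.sum_comm
    _ ≤ 12 ^ d * ((6 ^ n)⁻¹ * ∑ p : Fin 3, ∑ x : Fin n → Fin 3 × Bool, C * M) := by
        gcongr with p _ x _
        exact h n a M ha hM x p
    _ = _ := by
        simp
        field_simp

lemma norm_coeff_sq_le {n : ℕ} (a : (Fin n → Fin 4) → ℂ) {M : ℝ}
    (hM : ∀ x : Fin n → Fin 3 × Bool, ‖formEval a fun j => blochVec (x j)‖ ≤ M)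
    (s : Fin n → Fin 4) :
    (∏ j, if s j = 0 then (1 : ℝ) else 1 / 3) * ‖a s‖ ^ 2 ≤ M ^ 2 := by
  have hw : ∀ s : Fin n → Fin 4, 0 ≤ ∏ j, if s j = 0 then (1 : ℝ) else 1 / 3 := fun s =>
    Finset.prod_nonneg fun j _ => by split_ifs <;> norm_num
  refine (Finset.single_le_sum (f := fun s : Fin n → Fin 4 =>
    (∏ j, if s j = 0 then (1 : ℝ) else 1 / 3) * ‖a s‖ ^ 2)
    (fun s _ => mul_nonneg (hw s) (by positivity)) (Finset.mem_univ s)).trans ?_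
  refine le_of_mul_le_mul_left ?_ (show (0 : ℝ) < 6 ^ n by positivity)
  rw [← sum_norm_formEval_sq]
  calc _ ≤ ∑ x : Fin n → Fin 3 × Bool, M ^ 2 := by
        gcongr with x _
        exact hM x
    _ = _ := by simp

/-- Qubit Bohnenblust–Hille inequality: for every `d ≥ 1` there is `C(d) > 0` such that for
all `n ≥ 1` and every `A = ∑_s Â_s σ_s ∈ M₂(ℂ)^{⊗n}` of degree at most `d`,
`(∑_s |Â_s|^{2d/(d+1)})^{(d+1)/(2d)} ≤ C(d) ‖A‖` where `‖·‖` is the operator norm. -/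
theorem stmt9 (d : ℕ) (hd : 1 ≤ d) :
    ∃ C : ℝ, 0 < C ∧ ∀ n : ℕ, 1 ≤ n →
      ∀ Ahat : (Fin n → Fin 4) → ℂ,
        (∀ s : Fin n → Fin 4,
          d < (Finset.univ.filter (fun j => s j ≠ 0)).card → Ahat s = 0) →
        (∑ s : Fin n → Fin 4, ‖Ahat s‖ ^ ((2 * (d : ℝ)) / ((d : ℝ) + 1)))
            ^ (((d : ℝ) + 1) / (2 * (d : ℝ)))
          ≤ C * ‖Matrix.toEuclideanCLM (𝕜 := ℂ)
              (∑ s : Fin n → Fin 4, Ahat s • pauliTensor s)‖ := by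
  obtain ⟨K, hK, h⟩ := exists_sum_sqrt_le d
  refine ⟨4 * (K + 1), by positivity, fun n _ a ha => ?_⟩
  set M := ‖Matrix.toEuclideanCLM (𝕜 := ℂ) (∑ s : Fin n → Fin 4, a s • pauliTensor s)‖ with hMdef
  have hM : ∀ x : Fin n → Fin 3 × Bool, ‖formEval a fun j => blochVec (x j)‖ ≤ M :=
    norm_formEval_blochVec_le a
  have hd0 : (0 : ℝ) < d := by exact_mod_cast hd
  set q : ℝ := 2 * (d : ℝ) / (d + 1) with hq
  have hq0 : 0 < q := by positivity
  have hqinv : ((d : ℝ) + 1) / (2 * d) = q⁻¹ := by rw [hq, inv_div]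
  have hq1 : q⁻¹ ≤ 1 := by
    rw [← hqinv, div_le_one (by positivity)]
    have : (1 : ℝ) ≤ d := by exact_mod_cast hd
    linarith
  rw [hqinv]
  have hM0 : 0 ≤ M := norm_nonneg _
  set R : Fin n → Fin 4 → ℝ := fun j p => √(∑ s, if s j = p then ‖a s‖ ^ 2 else 0) with hRdef
  have hR : ∑ j, ∑ p : Fin 3, R j p.succ ≤ K * M := h n a M ha hM
  have hsq : ∀ j p, R j p ^ 2 = ∑ s, if s j = p then ‖a s‖ ^ 2 else 0 := fun j p =>
    Real.sq_sqrt (Finset.sum_nonneg fun s _ => by split_ifs <;> positivity)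
  rcases hM0.eq_or_lt with hz | hpos
  · have ha0 : ∀ s, a s = 0 := fun s => by
      have hw : 0 < ∏ j, if s j = 0 then (1 : ℝ) else 1 / 3 :=
        Finset.prod_pos fun j _ => by split_ifs <;> norm_num
      have h1 := norm_coeff_sq_le a hM s
      rw [← hz, zero_pow two_ne_zero] at h1
      have h2 : ‖a s‖ ^ 2 ≤ 0 := nonpos_of_mul_nonpos_right h1 hw
      simpa using le_antisymm h2 (sq_nonneg _)
    simp [ha0, Real.zero_rpow hq0.ne', Real.zero_rpow (inv_pos.2 hq0).ne', ← hz]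
  · set L := (K + 1) * M with hL
    have hL0 : 0 < L := by positivity
    have hKL : K * M ≤ L := by rw [hL]; linarith
    have hML : M ≤ L := by rw [hL]; linarith [mul_nonneg hK hM0]
    have hale : ∀ s, ‖a s‖ ≤ L := fun s => by
      by_cases hs : ∀ j, s j = 0
      · have h1 := norm_coeff_sq_le a hM s
        simp only [hs, if_true, Finset.prod_const_one, one_mul] at h1
        exact (abs_le_of_sq_le_sq' h1 hM0).2.trans hML
      · push Not at hs
        obtain ⟨j, hj⟩ := hs
        obtain ⟨p, hp⟩ := Fin.exists_succ_eq.2 hj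
        have h1 : ‖a s‖ ^ 2 ≤ R j p.succ ^ 2 := by
          rw [hsq]
          refine le_trans (le_of_eq ?_) (Finset.single_le_sum (f := fun s : Fin n → Fin 4 =>
            if s j = p.succ then ‖a s‖ ^ 2 else 0) (fun s _ => ?_) (Finset.mem_univ s))
          · simp [hp]
          · split_ifs <;> positivity
        have h2 : R j p.succ ≤ K * M := by
          refine le_trans ?_ hR
          refine le_trans ?_ (Finset.single_le_sum (f := fun j => ∑ p : Fin 3, R j p.succ)
            (fun j _ => Finset.sum_nonneg fun p _ => Real.sqrt_nonneg _) (Finset.mem_univ j))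
          exact Finset.single_le_sum (f := fun p : Fin 3 => R j p.succ)
            (fun p _ => Real.sqrt_nonneg _) (Finset.mem_univ p)
        exact (abs_le_of_sq_le_sq' h1 (Real.sqrt_nonneg _)).2.trans (h2.trans hKL)
    have hblei := sum_rpow_le_four hd (fun s => ‖a s‖ / L) (fun j p => R j p / L)
      (fun s => by positivity) (fun s => (div_le_one hL0).2 (hale s))
      (fun s hs => by simp [ha s hs]) (fun j p => by positivity)
      (fun j p => by
        rw [div_pow, hsq, Finset.sum_div]
        refine le_of_eq (Finset.sum_congr rfl fun s _ => ?_)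
        rw [ite_div, zero_div, div_pow])
      (by
        simp_rw [← Finset.sum_div]
        exact (div_le_one hL0).2 (hR.trans hKL))
    have hsum : ∑ s, ‖a s‖ ^ q = L ^ q * ∑ s, (‖a s‖ / L) ^ q := by
      rw [Finset.mul_sum]
      refine Finset.sum_congr rfl fun s _ => ?_
      rw [← Real.mul_rpow hL0.le (by positivity), mul_div_cancel₀ _ hL0.ne']
    have hs0 : 0 ≤ ∑ s, (‖a s‖ / L) ^ q := Finset.sum_nonneg fun s _ => by positivity
    calc (∑ s, ‖a s‖ ^ q) ^ q⁻¹ = L * (∑ s, (‖a s‖ / L) ^ q) ^ q⁻¹ := by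
          rw [hsum, Real.mul_rpow (by positivity) hs0, Real.rpow_rpow_inv hL0.le hq0.ne']
      _ ≤ L * (4 : ℝ) ^ q⁻¹ := by gcongr
      _ ≤ L * 4 := by
          gcongr
          exact (Real.rpow_le_rpow_of_exponent_le (by norm_num) hq1).trans_eq (Real.rpow_one 4)
      _ = 4 * (K + 1) * M := by rw [hL]; ring
end
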